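/- Let F be a finite field of odd order q and characteristic p, and let π be a set of primes with 2 ∈ π, 3 ∈ π, and p ∉ π. If H is a π-Hall subgroup of SL_2(F), then there exists a subgroup K of SL_2(F) whose order is a π-number such that no conjugate of K in SL_2(F) is contained in H. In particular, SL_2(F) does not satisfy D_π. -/

import Mathlib

/-- `n` is a `π`-number: every prime dividing `n` lies in `π`. -/
def IsPiNumber (π : Set ℕ) (n : ℕ) : Prop :=
  ∀ p : ℕ, p.Prime → p ∣ n → p ∈ π

/-- `H` is a `π`-Hall subgroup of `G`: its order is a `π`-number and no prime
in `π` divides its index. -/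
def IsHallPi (π : Set ℕ) {G : Type*} [Group G] (H : Subgroup G) : Prop :=
  IsPiNumber π (Nat.card H) ∧ ∀ p ∈ π, p.Prime → ¬ p ∣ H.index

/-- The conjugate `g K g⁻¹` of a subgroup `K`. -/
def conjSub {G : Type*} [Group G] (g : G) (K : Subgroup G) : Subgroup G :=
  K.map (MulAut.conj g).toMonoidHom

/-- `G` satisfies `E_π`: it possesses a `π`-Hall subgroup. -/
def EPi (π : Set ℕ) (G : Type*) [Group G] : Prop :=
  ∃ H : Subgroup G, IsHallPi π H

/-- `G` satisfies `C_π`: it satisfies `E_π` and any two `π`-Hall subgroups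
of `G` are conjugate in `G`. -/
def CPi (π : Set ℕ) (G : Type*) [Group G] : Prop :=
  EPi π G ∧ ∀ H K : Subgroup G, IsHallPi π H → IsHallPi π K → ∃ g : G, conjSub g H = K

/-- `G` satisfies `D_π`: it satisfies `C_π` and every `π`-subgroup of `G` is
contained in some `π`-Hall subgroup of `G`. -/
def DPi (π : Set ℕ) (G : Type*) [Group G] : Prop :=
  CPi π G ∧ ∀ K : Subgroup G, IsPiNumber π (Nat.card K) →
    ∃ H : Subgroup G, IsHallPi π H ∧ K ≤ H



section AbstractCounting

open Classical in
/-- The elements outside `Z` having a conjugate that commutes with `x`. -/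
noncomputable def torusClass {Γ : Type*} [Group Γ] [Fintype Γ] (Z : Subgroup Γ) (x : Γ) : Finset Γ :=
  Finset.univ.filter (fun z => z ∉ Z ∧ ∃ h : Γ, Commute x (h * z * h⁻¹))

open Classical in
/-- The centralizer of `x` as a finset. -/
noncomputable def centFin {Γ : Type*} [Group Γ] [Fintype Γ] (x : Γ) : Finset Γ :=
  Finset.univ.filter (fun z => Commute x z)

/-- Conjugators sending one element to another form a coset of the centralizer. -/
lemma card_conjugators {Γ : Type*} [Group Γ] [Fintype Γ] (z h0 : Γ)
    [DecidablePred (fun h : Γ => h * z * h⁻¹ = h0 * z * h0⁻¹)] :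
    (Finset.univ.filter (fun h : Γ => h * z * h⁻¹ = h0 * z * h0⁻¹)).card = (centFin z).card := by
  symm
  refine Finset.card_bij (fun c _ => h0 * c) ?_ ?_ ?_
  · intro c hc
    simp only [centFin, Finset.mem_filter, Finset.mem_univ, true_and] at hc ⊢
    have : c * z * c⁻¹ = z := by rw [← hc.eq]; group
    calc h0 * c * z * (h0 * c)⁻¹ = h0 * (c * z * c⁻¹) * h0⁻¹ := by group
      _ = _ := by rw [this]
  · intro a _ b _ h
    exact mul_left_cancel h
  · intro h hh
    simp only [centFin, Finset.mem_filter, Finset.mem_univ, true_and] at hh ⊢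
    refine ⟨h0⁻¹ * h, ?_, by group⟩
    have : h0⁻¹ * (h * z * h⁻¹) * h = h0⁻¹ * (h0 * z * h0⁻¹) * h := by rw [hh]
    have h2 : h0⁻¹ * h * z = z * (h0⁻¹ * h) := by
      calc h0⁻¹ * h * z = h0⁻¹ * (h * z * h⁻¹) * h := by group
        _ = _ := by rw [this]; group
    exact h2.symm

lemma card_cent_conj {Γ : Type*} [Group Γ] [Fintype Γ] (z h0 : Γ) :
    (centFin (h0 * z * h0⁻¹)).card = (centFin z).card := by
  classical
  symm
  refine Finset.card_bij (fun c _ => h0 * c * h0⁻¹) ?_ ?_ ?_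
  · intro c hc
    simp only [centFin, Finset.mem_filter, Finset.mem_univ, true_and] at hc ⊢
    exact (Commute.conj_iff h0).2 hc
  · intro a _ b _ h
    simpa using h
  · intro c hc
    simp only [centFin, Finset.mem_filter, Finset.mem_univ, true_and] at hc ⊢
    refine ⟨h0⁻¹ * c * h0, ?_, by group⟩
    have : c = h0 * (h0⁻¹ * c * h0) * h0⁻¹ := by group
    rw [this] at hc
    exact (Commute.conj_iff h0).1 hc

section
variable {Γ : Type*} [Group Γ] [Fintype Γ] (Z : Subgroup Γ)

open Classical in
lemma double_count (hZc : ∀ z ∈ Z, ∀ g : Γ, g * z * g⁻¹ = z) (hZ2 : Nat.card Z = 2) (x : Γ) :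
    Fintype.card Γ * ((centFin x).card - 2) =
      ∑ z ∈ torusClass Z x,
        (Finset.univ.filter (fun h : Γ => Commute x (h * z * h⁻¹))).card := by
  classical
  have key := Finset.sum_card_bipartiteAbove_eq_sum_card_bipartiteBelow
    (s := (Finset.univ : Finset Γ)) (t := torusClass Z x)
    (fun h z => Commute x (h * z * h⁻¹))
  simp only [Finset.bipartiteAbove, Finset.bipartiteBelow] at key
  rw [← key]
  have hZcard : (Finset.univ.filter (fun z => z ∈ Z)).card = 2 := by
    rw [← hZ2, Nat.card_eq_fintype_card, Fintype.card_subtype]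
  have each : ∀ h ∈ (Finset.univ : Finset Γ),
      ((torusClass Z x).filter (fun z => Commute x (h * z * h⁻¹))).card = (centFin x).card - 2 := by
    intro h _
    have h1 : (centFin x \ Finset.univ.filter (fun z => z ∈ Z)).card = (centFin x).card - 2 := by
      rw [Finset.card_sdiff_of_subset, hZcard]
      intro z hz
      simp only [centFin, Finset.mem_filter, Finset.mem_univ, true_and] at hz ⊢
      have := hZc z hz x
      exact mul_inv_eq_iff_eq_mul.1 this
    rw [← h1]
    refine Finset.card_bij (fun c _ => h * c * h⁻¹) ?_ ?_ ?_
    · intro c hc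
      simp only [torusClass, centFin, Finset.mem_filter, Finset.mem_univ, true_and,
        Finset.mem_sdiff] at hc ⊢
      refine ⟨hc.2, fun hz => hc.1.1 ?_⟩
      have := hZc _ hz h⁻¹
      have h3 : c = h * c * h⁻¹ := by rw [← this]; group
      rw [h3]; exact hz
    · intro a _ b _ h
      simpa using h
    · intro c hc
      simp only [torusClass, centFin, Finset.mem_filter, Finset.mem_univ, true_and,
        Finset.mem_sdiff] at hc ⊢
      have e : h * (h⁻¹ * c * h) * h⁻¹ = c := by group
      refine ⟨h⁻¹ * c * h, ⟨⟨fun hz => hc.2 ?_, h, ?_⟩, ?_⟩, e⟩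
      · have := hZc _ hz h
        rw [e] at this
        rw [this]; exact hz
      · rw [e]; exact hc.1
      · rw [e]; exact hc.1
  rw [Finset.sum_congr rfl each, Finset.sum_const, smul_eq_mul, Finset.card_univ]

lemma cent_eq
    (htr : ∀ x y z : Γ, y ∉ Z → Commute x y → Commute y z → Commute x z)
    {x y : Γ} (hx : x ∉ Z) (hy : y ∉ Z) (h : Commute x y) : centFin x = centFin y := by
  ext z
  simp only [centFin, Finset.mem_filter, Finset.mem_univ, true_and]
  exact ⟨fun hz => htr y x z hx h.symm hz, fun hz => htr x y z hy h hz⟩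

open Classical in
lemma fibre_le
    (hZc : ∀ z ∈ Z, ∀ g : Γ, g * z * g⁻¹ = z)
    (htr : ∀ x y z : Γ, y ∉ Z → Commute x y → Commute y z → Commute x z)
    (hinv : ∀ x n : Γ, x ∉ Z → Commute x (n * x * n⁻¹) → n * x * n⁻¹ = x ∨ n * x * n⁻¹ = x⁻¹)
    {x z : Γ} (hx : x ∉ Z) (hz : z ∈ torusClass Z x) :
    (Finset.univ.filter (fun h : Γ => Commute x (h * z * h⁻¹))).card ≤ 2 * (centFin x).card := by
  classical
  simp only [torusClass, Finset.mem_filter, Finset.mem_univ, true_and] at hz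
  obtain ⟨hzZ, h0, hh0⟩ := hz
  have hnot : ∀ h : Γ, h * z * h⁻¹ ∉ Z := by
    intro h hh
    have := hZc _ hh h⁻¹
    have h3 : z = h * z * h⁻¹ := by rw [← this]; group
    exact hzZ (by rw [h3]; exact hh)
  have hcz : (centFin z).card = (centFin x).card := by
    rw [← card_cent_conj z h0, cent_eq Z htr hx (hnot h0) hh0]
  have hsub : ∀ h : Γ, Commute x (h * z * h⁻¹) →
      h * z * h⁻¹ = h0 * z * h0⁻¹ ∨ h * z * h⁻¹ = (h0 * z * h0⁻¹)⁻¹ := by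
    intro h hh
    have e : h * z * h⁻¹ = (h * h0⁻¹) * (h0 * z * h0⁻¹) * (h * h0⁻¹)⁻¹ := by group
    have := hinv (h0 * z * h0⁻¹) (h * h0⁻¹) (hnot h0)
      (by rw [← e]; exact htr _ x _ hx hh0.symm hh)
    rwa [← e] at this
  by_cases hex : ∃ h1 : Γ, h1 * z * h1⁻¹ = (h0 * z * h0⁻¹)⁻¹
  · obtain ⟨h1, hh1⟩ := hex
    calc _ ≤ (Finset.univ.filter (fun h : Γ => h * z * h⁻¹ = h0 * z * h0⁻¹) ∪
          Finset.univ.filter (fun h : Γ => h * z * h⁻¹ = h1 * z * h1⁻¹)).card := by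
          apply Finset.card_le_card
          intro h hh
          simp only [Finset.mem_filter, Finset.mem_univ, true_and, Finset.mem_union] at hh ⊢
          rw [hh1]; exact hsub h hh
      _ ≤ _ := Finset.card_union_le _ _
      _ = _ := by rw [card_conjugators, card_conjugators, hcz]; ring
  · calc _ ≤ (Finset.univ.filter (fun h : Γ => h * z * h⁻¹ = h0 * z * h0⁻¹)).card := by
          apply Finset.card_le_card
          intro h hh
          simp only [Finset.mem_filter, Finset.mem_univ, true_and] at hh ⊢
          rcases hsub h hh with h1 | h1
          · exact h1
          · exact absurd ⟨h, h1⟩ hex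
      _ = _ := card_conjugators _ _
      _ ≤ _ := by rw [hcz]; omega

open Classical in
lemma fibre_ge
    (hZc : ∀ z ∈ Z, ∀ g : Γ, g * z * g⁻¹ = z)
    (htr : ∀ x y z : Γ, y ∉ Z → Commute x y → Commute y z → Commute x z)
    (hne : ∀ x : Γ, x ∉ Z → x ≠ x⁻¹) {x z w : Γ} (hx : x ∉ Z)
    (hw : ∀ y, Commute x y → w * y * w⁻¹ = y⁻¹) (hz : z ∈ torusClass Z x) :
    2 * (centFin x).card ≤ (Finset.univ.filter (fun h : Γ => Commute x (h * z * h⁻¹))).card := by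
  classical
  simp only [torusClass, Finset.mem_filter, Finset.mem_univ, true_and] at hz
  obtain ⟨hzZ, h0, hh0⟩ := hz
  have hnot : ∀ h : Γ, h * z * h⁻¹ ∉ Z := by
    intro h hh
    have := hZc _ hh h⁻¹
    have h3 : z = h * z * h⁻¹ := by rw [← this]; group
    exact hzZ (by rw [h3]; exact hh)
  have hcz : (centFin z).card = (centFin x).card := by
    rw [← card_cent_conj z h0, cent_eq Z htr hx (hnot h0) hh0]
  have e : (w * h0) * z * (w * h0)⁻¹ = (h0 * z * h0⁻¹)⁻¹ := by
    rw [← hw _ hh0]; group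
  calc 2 * (centFin x).card =
        (Finset.univ.filter (fun h : Γ => h * z * h⁻¹ = h0 * z * h0⁻¹) ∪
          Finset.univ.filter (fun h : Γ => h * z * h⁻¹ = (w * h0) * z * (w * h0)⁻¹)).card := by
          rw [Finset.card_union_of_disjoint, card_conjugators, card_conjugators, hcz]
          · ring
          · rw [Finset.disjoint_filter]
            intro h _ h1 h2
            rw [h1, e] at h2
            exact hne _ (hnot h0) h2
    _ ≤ _ := by
          apply Finset.card_le_card
          intro h hh
          simp only [Finset.mem_filter, Finset.mem_univ, true_and, Finset.mem_union] at hh ⊢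
          rcases hh with hh | hh
          · rw [hh]; exact hh0
          · rw [hh, e]; exact hh0.inv_right

theorem count_main
    (hZc : ∀ z ∈ Z, ∀ g : Γ, g * z * g⁻¹ = z)
    (hZ2 : Nat.card Z = 2)
    (htr : ∀ x y z : Γ, y ∉ Z → Commute x y → Commute y z → Commute x z)
    (hinv : ∀ x n : Γ, x ∉ Z → Commute x (n * x * n⁻¹) → n * x * n⁻¹ = x ∨ n * x * n⁻¹ = x⁻¹)
    (hne : ∀ x : Γ, x ∉ Z → x ≠ x⁻¹) {x y v w : Γ} (hx : x ∉ Z) (hy : y ∉ Z)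
    (hv : ∀ z, Commute x z → v * z * v⁻¹ = z⁻¹) (hw : ∀ z, Commute y z → w * z * w⁻¹ = z⁻¹)
    (hxy : ∀ h : Γ, ¬ Commute x (h * y * h⁻¹)) {a b : ℕ} (ha : (centFin x).card = a)
    (hb : (centFin y).card = b) (hab : Fintype.card Γ = a * b) (ha2 : 2 < a) (hb2 : 2 < b) :
    a * b + 8 ≤ 4 * a + 4 * b := by
  classical
  have up : ∀ x : Γ, x ∉ Z → Fintype.card Γ * ((centFin x).card - 2) ≤
      (torusClass Z x).card * (2 * (centFin x).card) := by
    intro x hx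
    rw [double_count Z hZc hZ2 x]
    exact Finset.sum_le_card_nsmul _ _ _ (fun z hz => fibre_le Z hZc htr hinv hx hz)
  have lo : ∀ x w : Γ, x ∉ Z → (∀ z, Commute x z → w * z * w⁻¹ = z⁻¹) →
      (torusClass Z x).card * (2 * (centFin x).card) ≤
        Fintype.card Γ * ((centFin x).card - 2) := by
    intro x w hx hw
    rw [double_count Z hZc hZ2 x]
    exact Finset.card_nsmul_le_sum _ _ _ (fun z hz => fibre_ge Z hZc htr hne hx hw hz)
  have Ex := le_antisymm (up x hx) (lo x v hx hv)
  have Ey := le_antisymm (up y hy) (lo y w hy hw)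
  rw [ha, hab] at Ex
  rw [hb, hab] at Ey
  have Ex' : 2 * (torusClass Z x).card = b * (a - 2) := by
    apply Nat.eq_of_mul_eq_mul_left (show 0 < a by omega)
    linarith
  have Ey' : 2 * (torusClass Z y).card = a * (b - 2) := by
    apply Nat.eq_of_mul_eq_mul_left (show 0 < b by omega)
    linarith
  have hnot : ∀ z : Γ, z ∉ Z → ∀ h : Γ, h * z * h⁻¹ ∉ Z := by
    intro z hzZ h hh
    have := hZc _ hh h⁻¹
    have h3 : z = h * z * h⁻¹ := by rw [← this]; group
    exact hzZ (by rw [h3]; exact hh)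
  -- classes of non-related elements are disjoint
  have disj : ∀ x y : Γ, x ∉ Z → y ∉ Z → (∀ h : Γ, ¬ Commute x (h * y * h⁻¹)) →
      Disjoint (torusClass Z x) (torusClass Z y) := by
    intro x y hx hy h
    rw [Finset.disjoint_left]
    intro z hz1 hz2
    simp only [torusClass, Finset.mem_filter, Finset.mem_univ, true_and] at hz1 hz2
    obtain ⟨hz, h1, c1⟩ := hz1
    obtain ⟨_, h2, c2⟩ := hz2
    apply h (h1 * h2⁻¹)
    have c3 : Commute (h1 * h2⁻¹ * y * (h1 * h2⁻¹)⁻¹) (h1 * z * h1⁻¹) := by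
      have := (Commute.conj_iff (h1 * h2⁻¹)).2 c2
      convert this using 1
      group
    exact htr _ _ _ (hnot z hz h1) c1 c3.symm
  have hZcard : (Finset.univ.filter (fun z => z ∈ Z)).card = 2 := by
    rw [← hZ2, Nat.card_eq_fintype_card, Fintype.card_subtype]
  have dZ : ∀ x, Disjoint (torusClass Z x) (Finset.univ.filter (fun z => z ∈ Z)) := by
    intro x
    rw [Finset.disjoint_left]
    intro z hz1 hz2
    simp only [torusClass, Finset.mem_filter, Finset.mem_univ, true_and] at hz1 hz2
    exact hz1.1 hz2
  set U := (torusClass Z x ∪ torusClass Z y) ∪ Finset.univ.filter (fun z => z ∈ Z) with hU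
  have cU : U.card = (torusClass Z x).card + (torusClass Z y).card + 2 := by
    rw [hU, Finset.card_union_of_disjoint, Finset.card_union_of_disjoint (disj x y hx hy hxy),
      hZcard]
    exact Finset.disjoint_union_left.2 ⟨dZ x, dZ y⟩
  obtain ⟨a', rfl⟩ : ∃ a', a = a' + 2 := ⟨a - 2, by omega⟩
  obtain ⟨b', rfl⟩ : ∃ b', b = b' + 2 := ⟨b - 2, by omega⟩
  simp only [Nat.add_sub_cancel] at Ex' Ey'
  have hlt : U.card < (Finset.univ : Finset Γ).card := by
    rw [cU, Finset.card_univ, hab]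
    nlinarith
  obtain ⟨t, _, ht⟩ := Finset.exists_mem_notMem_of_card_lt_card hlt
  simp only [hU, Finset.mem_union, not_or] at ht
  obtain ⟨⟨ht1, ht2⟩, ht3⟩ := ht
  have htZ : t ∉ Z := by simpa using ht3
  have hx_t : ∀ h : Γ, ¬ Commute x (h * t * h⁻¹) := by
    intro h hc
    apply ht1
    simp only [torusClass, Finset.mem_filter, Finset.mem_univ, true_and]
    exact ⟨htZ, h, hc⟩
  have hy_t : ∀ h : Γ, ¬ Commute y (h * t * h⁻¹) := by
    intro h hc
    apply ht2
    simp only [torusClass, Finset.mem_filter, Finset.mem_univ, true_and]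
    exact ⟨htZ, h, hc⟩
  have ct : 4 ≤ (centFin t).card := by
    have h1 : (centFin t).card = Nat.card (Subgroup.centralizer {t}) := by
      rw [Nat.card_eq_fintype_card, Fintype.card_subtype]
      apply Finset.card_bij (fun c _ => c)
      · intro z hz
        simp only [centFin, Finset.mem_filter, Finset.mem_univ, true_and] at hz ⊢
        exact Subgroup.mem_centralizer_singleton_iff.2 hz.symm.eq
      · intro _ _ _ _ h
        exact h
      · intro z hz
        simp only [centFin, Finset.mem_filter, Finset.mem_univ, true_and] at hz ⊢
        exact ⟨z, (Subgroup.mem_centralizer_singleton_iff.1 hz).symm, rfl⟩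
    have h2 : Z ≤ Subgroup.centralizer {t} := by
      intro z hz
      rw [Subgroup.mem_centralizer_singleton_iff]
      exact (mul_inv_eq_iff_eq_mul.1 (hZc z hz t)).symm
    have h3 := Subgroup.card_dvd_of_le h2
    have h4 : Nat.card (Subgroup.centralizer {t}) ≠ 2 := by
      intro h4
      have := Subgroup.eq_of_le_of_card_ge h2 (by rw [h4, hZ2])
      apply htZ
      rw [this, Subgroup.mem_centralizer_singleton_iff]
    have h5 : 0 < Nat.card (Subgroup.centralizer {t}) := Nat.card_pos
    rw [h1]
    rw [hZ2] at h3
    omega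
  have Et := up t htZ
  have Et' : Fintype.card Γ ≤ 4 * (torusClass Z t).card := by
    obtain ⟨c, hc⟩ : ∃ c, (centFin t).card = c + 4 := ⟨_, (Nat.sub_add_cancel ct).symm⟩
    rw [hc] at Et
    have : c + 4 - 2 = c + 2 := by omega
    rw [this] at Et
    by_contra hcon
    push Not at hcon
    nlinarith
  have cV : (U ∪ torusClass Z t).card ≤ Fintype.card Γ := Finset.card_le_univ _
  rw [Finset.card_union_of_disjoint, cU] at cV
  · rw [hab] at cV Et'
    nlinarith
  · rw [hU]
    refine Finset.disjoint_union_left.2 ⟨Finset.disjoint_union_left.2 ⟨?_, ?_⟩, (dZ t).symm⟩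
    · exact disj x t hx htZ hx_t
    · exact disj y t hy htZ hy_t

end

end AbstractCounting


section Extensions

open Classical in
lemma ext_sub {G : Type*} [Group G] [Finite G] (N : Subgroup G) (w : G) (n : ℕ) (hn : n.Prime)
    (hnorm : ∀ y ∈ N, w * y * w⁻¹ ∈ N) (hwn : w ^ n ∈ N) (hw : w ∉ N) :
    ∃ L : Subgroup G, N ≤ L ∧ w ∈ L ∧ Nat.card L = n * Nat.card N ∧ (∀ x ∈ L, x ^ n ∈ N) ∧
      (∀ x ∈ L, ∃ m < n, ∃ y ∈ N, x = y * w ^ m) := by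
  have hwN : w ∈ Subgroup.normalizer (N : Set G) := by
    rw [Subgroup.mem_normalizer_iff]
    intro y
    refine ⟨hnorm y, fun hy => ?_⟩
    have hinj : Function.Injective (fun y : N => (⟨w * y * w⁻¹, hnorm y y.2⟩ : N)) := by
      intro a b h
      have h' := congrArg Subtype.val h
      exact Subtype.ext (mul_left_cancel (mul_right_cancel h'))
    obtain ⟨z, hz⟩ := (Finite.injective_iff_surjective.1 hinj) ⟨_, hy⟩
    simp only [Subtype.mk.injEq] at hz
    have : (z : G) = y := by simpa using hz
    rw [← this]; exact z.2
  set R := Subgroup.normalizer (N : Set G) with hR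
  set N' := N.subgroupOf R with hN'
  let w' : R := ⟨w, hwN⟩
  let f := QuotientGroup.mk' N'
  have hfw : ∀ r : R, f r = 1 ↔ (r : G) ∈ N := by
    intro r
    rw [QuotientGroup.mk'_apply, QuotientGroup.eq_one_iff, hN', Subgroup.mem_subgroupOf]
  have hord : orderOf (f w') = n := by
    have := Fact.mk hn
    apply orderOf_eq_prime
    · rw [← map_pow, hfw]; exact hwn
    · rw [Ne, hfw]; exact hw
  let L' := (Subgroup.zpowers (f w')).comap f
  have hNR : N ≤ R := Subgroup.le_normalizer
  have hmemL : ∀ r : R, r ∈ L' → ∃ m < n, ∃ y ∈ N, (r : G) = y * w ^ m := by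
    intro r hr
    have hr : f r ∈ Subgroup.zpowers (f w') := hr
    rw [mem_zpowers_iff_mem_range_orderOf, hord] at hr
    simp only [Finset.mem_image, Finset.mem_range] at hr
    obtain ⟨m, hm, he⟩ := hr
    refine ⟨m, hm, r * (w ^ m)⁻¹, ?_, by group⟩
    have := hfw (r * (w' ^ m)⁻¹)
    rw [map_mul, map_inv, map_pow, he, mul_inv_cancel] at this
    simpa [w'] using this
  refine ⟨L'.map R.subtype, ?_, ?_, ?_, ?_, ?_⟩
  · intro y hy
    refine ⟨⟨y, hNR hy⟩, ?_, rfl⟩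
    change f ⟨y, hNR hy⟩ ∈ Subgroup.zpowers _
    rw [(hfw ⟨y, hNR hy⟩).2 hy]
    exact one_mem _
  · refine ⟨w', ?_, rfl⟩
    exact Subgroup.mem_zpowers (f w')
  · rw [Subgroup.card_map_of_injective R.subtype_injective]
    have hle : N' ≤ L' := by
      intro r hr
      change f r ∈ Subgroup.zpowers _
      rw [(hfw r).2 hr]
      exact one_mem _
    have h1 := Subgroup.relIndex_comap ⊥ f L'
    have h2 : (⊥ : Subgroup (R ⧸ N')).comap f = N' := by
      rw [MonoidHom.comap_bot]; exact QuotientGroup.ker_mk' N'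
    rw [h2, Subgroup.map_comap_eq_self_of_surjective (QuotientGroup.mk'_surjective N'),
      Subgroup.relIndex_bot_left, Nat.card_zpowers, hord] at h1
    have h3 := Subgroup.relIndex_mul_relIndex ⊥ N' L' bot_le hle
    rw [Subgroup.relIndex_bot_left, Subgroup.relIndex_bot_left, h1] at h3
    rw [← h3, mul_comm]
    congr 1
    exact Nat.card_congr (Subgroup.subgroupOfEquivOfLe hNR).toEquiv
  · rintro _ ⟨r, hr, rfl⟩
    have hr : f r ∈ Subgroup.zpowers (f w') := hr
    have := (hfw (r ^ n)).1 (by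
      rw [map_pow]
      obtain ⟨k, hk⟩ := hr
      simp only at hk
      rw [← hk, ← zpow_natCast, ← zpow_mul, mul_comm, zpow_mul, zpow_natCast, ← hord,
        pow_orderOf_eq_one, one_zpow])
    simpa using this
  · rintro _ ⟨r, hr, rfl⟩
    exact hmemL r hr

/-- Every square of `H` lies in a subgroup `D ≤ H` with `|H| ≤ 2 |D|`. -/
lemma sq_mem_of_card {G : Type*} [Group G] [Finite G] {D H : Subgroup G} (h : D ≤ H)
    (hc : Nat.card H ≤ 2 * Nat.card D) {x : G} (hx : x ∈ H) : x ^ 2 ∈ D := by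
  have h3 := Subgroup.relIndex_mul_relIndex ⊥ D H bot_le h
  rw [Subgroup.relIndex_bot_left, Subgroup.relIndex_bot_left] at h3
  have hpos : 0 < Nat.card D := Nat.card_pos
  have hpos' : 0 < Nat.card H := Nat.card_pos
  have hle : D.relIndex H ≤ 2 := by
    by_contra hcon
    push Not at hcon
    nlinarith
  have hne : D.relIndex H ≠ 0 := by
    intro h0
    rw [h0] at h3; omega
  have : D.relIndex H = 1 ∨ D.relIndex H = 2 := by omega
  rcases this with h1 | h1
  · exact pow_mem (Subgroup.relIndex_eq_one.1 h1 hx) 2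
  · have := Subgroup.sq_mem_of_index_two (H := D.subgroupOf H) h1 ⟨x, hx⟩
    simpa [Subgroup.mem_subgroupOf] using this

lemma cube_mem_of_card {G : Type*} [Group G] [Finite G] {D H : Subgroup G} (h : D ≤ H)
    (hc : Nat.card H ≤ 2 * Nat.card D) {x : G} (hx : x ∈ H) (hx3 : x ^ 3 = 1) : x ∈ D := by
  have h1 := sq_mem_of_card h hc (pow_mem hx 2)
  have : (x ^ 2) ^ 2 = x := by
    rw [← pow_mul, show 2 * 2 = 3 + 1 from rfl, pow_succ, hx3, one_mul]
  rwa [this] at h1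

end Extensions


section Matrices

open Matrix

variable {F : Type*} [Field F]

lemma sl_ext {A B : SpecialLinearGroup (Fin 2) F} (h00 : A 0 0 = B 0 0) (h01 : A 0 1 = B 0 1)
    (h10 : A 1 0 = B 1 0) (h11 : A 1 1 = B 1 1) : A = B := by
  ext i j
  fin_cases i <;> fin_cases j <;> assumption

lemma sl_det (A : SpecialLinearGroup (Fin 2) F) : A 0 0 * A 1 1 - A 0 1 * A 1 0 = 1 := by
  have := A.det_coe
  rwa [Matrix.det_fin_two] at this

lemma sl_mul (A B : SpecialLinearGroup (Fin 2) F) (i j : Fin 2) :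
    (A * B) i j = A i 0 * B 0 j + A i 1 * B 1 j := by
  have h : (A.1 * B.1) i j = A.1 i 0 * B.1 0 j + A.1 i 1 * B.1 1 j := by
    rw [Matrix.mul_apply, Fin.sum_univ_two]
  exact h

lemma sl_one00 : (1 : SpecialLinearGroup (Fin 2) F) 0 0 = 1 := rfl
lemma sl_one01 : (1 : SpecialLinearGroup (Fin 2) F) 0 1 = 0 := rfl
lemma sl_one10 : (1 : SpecialLinearGroup (Fin 2) F) 1 0 = 0 := rfl
lemma sl_one11 : (1 : SpecialLinearGroup (Fin 2) F) 1 1 = 1 := rfl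

lemma sl_inv00 (A : SpecialLinearGroup (Fin 2) F) : A⁻¹ 0 0 = A 1 1 := by
  have h : A.1.adjugate 0 0 = A.1 1 1 := by rw [Matrix.adjugate_fin_two]; rfl
  exact h
lemma sl_inv01 (A : SpecialLinearGroup (Fin 2) F) : A⁻¹ 0 1 = - A 0 1 := by
  have h : A.1.adjugate 0 1 = -A.1 0 1 := by rw [Matrix.adjugate_fin_two]; rfl
  exact h
lemma sl_inv10 (A : SpecialLinearGroup (Fin 2) F) : A⁻¹ 1 0 = - A 1 0 := by
  have h : A.1.adjugate 1 0 = -A.1 1 0 := by rw [Matrix.adjugate_fin_two]; rfl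
  exact h
lemma sl_inv11 (A : SpecialLinearGroup (Fin 2) F) : A⁻¹ 1 1 = A 0 0 := by
  have h : A.1.adjugate 1 1 = A.1 0 0 := by rw [Matrix.adjugate_fin_two]; rfl
  exact h

lemma sl_neg (A : SpecialLinearGroup (Fin 2) F) (i j : Fin 2) : (-A) i j = - A i j := by
  rw [SpecialLinearGroup.coe_neg]; rfl

lemma sl_commute_iff (A B : SpecialLinearGroup (Fin 2) F) : Commute A B ↔
    A 0 1 * B 1 0 = B 0 1 * A 1 0 ∧ A 0 1 * (B 0 0 - B 1 1) = B 0 1 * (A 0 0 - A 1 1) ∧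
    A 1 0 * (B 0 0 - B 1 1) = B 1 0 * (A 0 0 - A 1 1) := by
  constructor
  · intro h
    have e : ∀ i j, (A * B) i j = (B * A) i j := by intro i j; rw [h.eq]
    have e00 := e 0 0
    have e01 := e 0 1
    have e10 := e 1 0
    simp only [sl_mul] at e00 e01 e10
    refine ⟨by linear_combination e00, by linear_combination -e01, by linear_combination e10⟩
  · rintro ⟨h1, h2, h3⟩
    apply sl_ext <;> simp only [sl_mul]
    · linear_combination h1
    · linear_combination -h2
    · linear_combination h3
    · linear_combination -h1

lemma sl_scalar {A : SpecialLinearGroup (Fin 2) F} (h1 : A 0 1 = 0) (h2 : A 1 0 = 0)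
    (h3 : A 0 0 - A 1 1 = 0) : A = 1 ∨ A = -1 := by
  have hd := sl_det A
  have h4 : A 1 1 = A 0 0 := by linear_combination -h3
  rw [h1, h4] at hd
  have : (A 0 0 - 1) * (A 0 0 + 1) = 0 := by linear_combination hd
  rcases mul_eq_zero.1 this with h | h
  · left
    have h : A 0 0 = 1 := by linear_combination h
    apply sl_ext <;> simp [h1, h2, h4, h]
  · right
    have h : A 0 0 = -1 := by linear_combination h
    apply sl_ext <;> simp [h1, h2, h4, h, sl_neg]

lemma sl_nonscalar {A : SpecialLinearGroup (Fin 2) F} (h1 : A ≠ 1) (h2 : A ≠ -1) :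
    A 0 1 ≠ 0 ∨ A 1 0 ≠ 0 ∨ A 0 0 - A 1 1 ≠ 0 := by
  by_contra h
  push Not at h
  rcases sl_scalar h.1 h.2.1 h.2.2 with h | h
  · exact h1 h
  · exact h2 h

lemma sl_commute_trans {x y z : SpecialLinearGroup (Fin 2) F} (h1 : y ≠ 1) (h2 : y ≠ -1)
    (hxy : Commute x y) (hyz : Commute y z) : Commute x z := by
  rw [sl_commute_iff] at *
  obtain ⟨a1, a2, a3⟩ := hxy
  obtain ⟨b1, b2, b3⟩ := hyz
  generalize x 0 0 - x 1 1 = xd at *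
  generalize z 0 0 - z 1 1 = zd at *
  have := sl_nonscalar h1 h2
  generalize y 0 0 - y 1 1 = yd at *
  generalize y 0 1 = y1 at *
  generalize y 1 0 = y2 at *
  generalize x 0 1 = x1 at *
  generalize x 1 0 = x2 at *
  generalize z 0 1 = z1 at *
  generalize z 1 0 = z2 at *
  rcases this with h | h | h
  · refine ⟨?_, ?_, ?_⟩ <;> apply mul_left_cancel₀ h <;> grind
  · refine ⟨?_, ?_, ?_⟩ <;> apply mul_left_cancel₀ h <;> grind
  · refine ⟨?_, ?_, ?_⟩ <;> apply mul_left_cancel₀ h <;> grind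

lemma sl_trace_conj (n x : SpecialLinearGroup (Fin 2) F) :
    (n * x * n⁻¹) 0 0 + (n * x * n⁻¹) 1 1 = x 0 0 + x 1 1 := by
  simp only [sl_mul, sl_inv00, sl_inv01, sl_inv10, sl_inv11]
  have := sl_det n
  linear_combination (x 0 0 + x 1 1) * this

lemma sl_conj_inv (h2 : (2 : F) ≠ 0) {x y : SpecialLinearGroup (Fin 2) F}
    (hd : (x 0 0 + x 1 1) ^ 2 - 4 ≠ 0) (htr : y 0 0 + y 1 1 = x 0 0 + x 1 1)
    (hc : Commute x y) : y = x ∨ y = x⁻¹ := by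
  rw [sl_commute_iff] at hc
  obtain ⟨a1, a2, a3⟩ := hc
  have dx := sl_det x
  have dy := sl_det y
  have hx : (x 0 0 + x 1 1) ^ 2 - 4 = (x 0 0 - x 1 1) ^ 2 + 4 * (x 0 1 * x 1 0) := by
    linear_combination 4 * dx
  have hy : (x 0 0 + x 1 1) ^ 2 - 4 = (y 0 0 - y 1 1) ^ 2 + 4 * (y 0 1 * y 1 0) := by
    rw [← htr]
    linear_combination 4 * dy
  -- `α` is the ratio of the traceless parts
  set δ := (x 0 0 + x 1 1) ^ 2 - 4 with hδ
  set β := (x 0 0 - x 1 1) * (y 0 0 - y 1 1) + 2 * (x 0 1 * y 1 0) + 2 * (x 1 0 * y 0 1) with hβ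
  have r1 : δ * (y 0 1) = β * x 0 1 := by
    rw [hx, hβ]; linear_combination (-2 * x 0 1) * a1 - (x 0 0 - x 1 1) * a2
  have r2 : δ * (y 1 0) = β * x 1 0 := by
    rw [hx, hβ]; linear_combination (2 * x 1 0) * a1 - (x 0 0 - x 1 1) * a3
  have r3 : δ * (y 0 0 - y 1 1) = β * (x 0 0 - x 1 1) := by
    rw [hx, hβ]; linear_combination 2 * x 1 0 * a2 + 2 * x 0 1 * a3
  have r4 : β ^ 2 = δ ^ 2 := by
    have : δ * (δ ^ 2) = δ * β ^ 2 := by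
      calc δ * δ ^ 2 = δ ^ 2 * ((y 0 0 - y 1 1) ^ 2 + 4 * (y 0 1 * y 1 0)) := by rw [← hy]; ring
        _ = (δ * (y 0 0 - y 1 1)) ^ 2 + 4 * ((δ * y 0 1) * (δ * y 1 0)) := by ring
        _ = β ^ 2 * ((x 0 0 - x 1 1) ^ 2 + 4 * (x 0 1 * x 1 0)) := by rw [r1, r2, r3]; ring
        _ = _ := by rw [← hx]; ring
    exact (mul_left_cancel₀ hd this).symm
  rcases sq_eq_sq_iff_eq_or_eq_neg.1 r4 with h | h
  · left
    rw [h] at r1 r2 r3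
    have r1 := mul_left_cancel₀ hd r1
    have r2 := mul_left_cancel₀ hd r2
    have r3 := mul_left_cancel₀ hd r3
    apply sl_ext
    · apply mul_left_cancel₀ h2; linear_combination r3 + htr
    · exact r1
    · exact r2
    · apply mul_left_cancel₀ h2; linear_combination htr - r3
  · right
    rw [h] at r1 r2 r3
    have r1 : y 0 1 = - x 0 1 := mul_left_cancel₀ hd (by linear_combination r1)
    have r2 : y 1 0 = - x 1 0 := mul_left_cancel₀ hd (by linear_combination r2)
    have r3 : y 0 0 - y 1 1 = - (x 0 0 - x 1 1) := mul_left_cancel₀ hd (by linear_combination r3)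
    apply sl_ext
    · rw [sl_inv00]; apply mul_left_cancel₀ h2; linear_combination r3 + htr
    · rw [sl_inv01]; exact r1
    · rw [sl_inv10]; exact r2
    · rw [sl_inv11]; apply mul_left_cancel₀ h2; linear_combination htr - r3

lemma sl_sq_eq_one (h2 : (2 : F) ≠ 0) {x : SpecialLinearGroup (Fin 2) F} (h : x = x⁻¹) :
    x = 1 ∨ x = -1 := by
  have e : ∀ i j, x i j = x⁻¹ i j := by intro i j; rw [← h]
  have e00 := e 0 0
  have e01 := e 0 1
  have e10 := e 1 0
  rw [sl_inv00] at e00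
  rw [sl_inv01] at e01
  rw [sl_inv10] at e10
  apply sl_scalar
  · apply mul_left_cancel₀ h2; linear_combination e01
  · apply mul_left_cancel₀ h2; linear_combination e10
  · linear_combination e00

lemma sl_one_ne_neg (h2 : (2 : F) ≠ 0) : (1 : SpecialLinearGroup (Fin 2) F) ≠ -1 := by
  intro h
  have : (1 : SpecialLinearGroup (Fin 2) F) 0 0 = (-1 : SpecialLinearGroup (Fin 2) F) 0 0 := by
    rw [← h]
  rw [sl_neg] at this
  rw [sl_one00] at this
  apply h2
  linear_combination this

/-- An element of order prime to `p` with trace `±2` is central. -/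
lemma sl_disc_ne_zero {p : ℕ} [hp : Fact p.Prime] [CharP F p] (h2 : (2 : F) ≠ 0)
    {x : SpecialLinearGroup (Fin 2) F} (hx1 : x ≠ 1) (hx2 : x ≠ -1)
    (hcop : ¬ p ∣ orderOf x) : (x 0 0 + x 1 1) ^ 2 - 4 ≠ 0 := by
  intro hd
  have hdet := sl_det x
  set t := x 0 0 + x 1 1 with ht
  have ch : (x : Matrix (Fin 2) (Fin 2) F) ^ 2 = t • (x : Matrix (Fin 2) (Fin 2) F) - 1 := by
    ext i j
    rw [pow_two]
    fin_cases i <;> fin_cases j <;>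
      simp [Matrix.mul_apply, Fin.sum_univ_two, ht] <;> grind
  set X := (x : Matrix (Fin 2) (Fin 2) F) with hX
  have hN : (X ^ 2 - 1) ^ 2 = 0 := by
    have e1 : X ^ 2 - 1 = t • X - (2 : F) • (1 : Matrix (Fin 2) (Fin 2) F) := by rw [ch]; module
    have e2 : (t • X - (2 : F) • (1 : Matrix (Fin 2) (Fin 2) F)) ^ 2 =
        t ^ 2 • X ^ 2 - (4 * t) • X + (4 : F) • (1 : Matrix (Fin 2) (Fin 2) F) := by
      rw [pow_two, sub_mul, mul_sub, mul_sub]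
      simp only [smul_mul_assoc, mul_smul_comm, mul_one, one_mul]
      rw [pow_two X]
      module
    have ht4 : t ^ 2 = 4 := by linear_combination hd
    rw [e1, e2, ch, ht4]
    module
  have hchar : (X ^ 2 - 1) ^ p = (X ^ 2) ^ p - 1 := by
    have := sub_pow_char_of_commute (p := p) (x := X ^ 2) (y := (1 : Matrix (Fin 2) (Fin 2) F))
      (Commute.one_right _)
    rwa [one_pow] at this
  have hz : (X ^ 2 - 1) ^ p = 0 := pow_eq_zero_of_le hp.1.two_le hN
  rw [hz] at hchar
  have hx2p : x ^ (2 * p) = 1 := by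
    apply Subtype.ext
    have : X ^ (2 * p) = 1 := by rw [pow_mul]; exact (sub_eq_zero.1 hchar.symm)
    exact this
  have hdvd := orderOf_dvd_of_pow_eq_one hx2p
  have hc : (orderOf x).Coprime p := ((Nat.Prime.coprime_iff_not_dvd hp.1).2 hcop).symm
  have : orderOf x ∣ 2 := hc.dvd_of_dvd_mul_right hdvd
  have hsq : x ^ 2 = 1 := orderOf_dvd_iff_pow_eq_one.1 this
  rcases sl_sq_eq_one h2 (eq_inv_of_mul_eq_one_left (by rw [← pow_two]; exact hsq)) with h | h
  · exact hx1 h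
  · exact hx2 h

end Matrices


section Tori

open Matrix

variable {F : Type*} [Field F]

lemma sl_exists (a b c d : F) (h : a * d - b * c = 1) : ∃ w : SpecialLinearGroup (Fin 2) F,
    w 0 0 = a ∧ w 0 1 = b ∧ w 1 0 = c ∧ w 1 1 = d :=
  ⟨⟨!![a, b; c, d], by rw [Matrix.det_fin_two_of]; exact h⟩, rfl, rfl, rfl, rfl⟩

/-- The torus of matrices `x + y M` with `M² = n`. -/
def torus (n : F) : Subgroup (SpecialLinearGroup (Fin 2) F) where
  carrier := {A | A 0 0 = A 1 1 ∧ A 0 1 = n * A 1 0}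
  mul_mem' := by
    rintro A B ⟨a1, a2⟩ ⟨b1, b2⟩
    constructor
    · simp only [sl_mul, a1, a2, b1, b2]; ring
    · simp only [sl_mul, a1, a2, b1, b2]; ring
  one_mem' := ⟨rfl, by rw [sl_one01, sl_one10, mul_zero]⟩
  inv_mem' := by
    rintro A ⟨a1, a2⟩
    refine ⟨?_, ?_⟩
    · rw [sl_inv00, sl_inv11, a1]
    · rw [sl_inv01, sl_inv10, a2]; ring

lemma mem_torus {n : F} {A : SpecialLinearGroup (Fin 2) F} :
    A ∈ torus n ↔ A 0 0 = A 1 1 ∧ A 0 1 = n * A 1 0 := Iff.rfl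

lemma torus_comm {n : F} {A B : SpecialLinearGroup (Fin 2) F} (hA : A ∈ torus n)
    (hB : B ∈ torus n) : Commute A B := by
  obtain ⟨a1, a2⟩ := hA
  obtain ⟨b1, b2⟩ := hB
  rw [sl_commute_iff, a1, a2, b1, b2]
  refine ⟨?_, ?_, ?_⟩ <;> ring

lemma torus_self {n : F} {A B : SpecialLinearGroup (Fin 2) F} (hA : A ∈ torus n)
    (h1 : A ≠ 1) (h2 : A ≠ -1) (hc : Commute A B) : B ∈ torus n := by
  have hns := sl_nonscalar h1 h2
  obtain ⟨a1, a2⟩ := hA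
  rw [sl_commute_iff, a1, a2] at hc
  obtain ⟨c1, c2, c3⟩ := hc
  have h10 : A 1 0 ≠ 0 := by
    intro h
    rw [a1, a2, h] at hns
    simp at hns
  refine ⟨?_, ?_⟩
  · apply mul_left_cancel₀ h10; linear_combination c3
  · apply mul_left_cancel₀ h10; linear_combination -c1

lemma torus_disc {n : F} {A : SpecialLinearGroup (Fin 2) F} (hA : A ∈ torus n) :
    ∃ s : F, (A 0 0 + A 1 1) ^ 2 - 4 = n * s ^ 2 := by
  have hd := sl_det A
  obtain ⟨a1, a2⟩ := hA
  refine ⟨2 * A 1 0, ?_⟩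
  rw [a1, a2] at hd
  rw [a1]
  linear_combination 4 * hd

lemma torus_cyclic [Finite F] (h2 : (2 : F) ≠ 0) {n : F} (hn : n ≠ 0) : IsCyclic (torus n) := by
  let K := AlgebraicClosure F
  obtain ⟨r, hr⟩ := IsAlgClosed.exists_pow_nat_eq (algebraMap F K n) (n := 2) (by norm_num)
  let ι := algebraMap F K
  have hr0 : r ≠ 0 := by
    rintro rfl
    apply hn
    apply (algebraMap F K).injective
    rw [map_zero, ← hr]; norm_num
  have hK2 : (2 : K) ≠ 0 := by
    intro h
    apply h2
    apply (algebraMap F K).injective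
    rw [map_zero, ← h]; exact map_ofNat (algebraMap F K) 2
  let f : torus n →* K :=
    { toFun := fun A => ι (A.1 0 0) + r * ι (A.1 1 0)
      map_one' := by
        have e1 : ((1 : torus n) : SpecialLinearGroup (Fin 2) F) 0 0 = 1 := rfl
        have e2 : ((1 : torus n) : SpecialLinearGroup (Fin 2) F) 1 0 = 0 := rfl
        rw [e1, e2, map_one, map_zero, mul_zero, add_zero]
      map_mul' := by
        rintro ⟨A, a1, a2⟩ ⟨B, b1, b2⟩
        have e1 : (A * B) 0 0 = A 0 0 * B 0 0 + n * A 1 0 * B 1 0 := by rw [sl_mul, a2]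
        have e2 : (A * B) 1 0 = A 1 0 * B 0 0 + A 0 0 * B 1 0 := by rw [sl_mul, a1]
        change ι ((A * B) 0 0) + r * ι ((A * B) 1 0) =
          (ι (A 0 0) + r * ι (A 1 0)) * (ι (B 0 0) + r * ι (B 1 0))
        rw [e1, e2]
        simp only [map_add, map_mul]
        have hr' : ι n = r ^ 2 := hr.symm
        rw [hr']; ring }
  apply isCyclic_of_injective_ringHom f
  rintro ⟨A, a1, a2⟩ ⟨B, b1, b2⟩ h
  change ι (A 0 0) + r * ι (A 1 0) = ι (B 0 0) + r * ι (B 1 0) at h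
  have key : ∀ A : SpecialLinearGroup (Fin 2) F, A 0 0 = A 1 1 → A 0 1 = n * A 1 0 →
      (ι (A 0 0) + r * ι (A 1 0)) * (ι (A 0 0) - r * ι (A 1 0)) = 1 := by
    intro A a1 a2
    have hd := congrArg ι (sl_det A)
    rw [← a1, a2] at hd
    simp only [map_sub, map_mul, map_one] at hd
    have hr' : ι n = r ^ 2 := hr.symm
    rw [hr'] at hd
    linear_combination hd
  have kA := key A a1 a2
  have kB := key B b1 b2
  rw [h] at kA
  have h' : ι (A 0 0) - r * ι (A 1 0) = ι (B 0 0) - r * ι (B 1 0) := by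
    have hne : ι (B 0 0) + r * ι (B 1 0) ≠ 0 := by
      intro h0; rw [h0, zero_mul] at kB; exact zero_ne_one kB
    apply mul_left_cancel₀ hne
    rw [kA, kB]
  have e1 : A 0 0 = B 0 0 := by
    apply (algebraMap F K).injective
    apply mul_left_cancel₀ hK2
    linear_combination h + h'
  have e2 : A 1 0 = B 1 0 := by
    apply (algebraMap F K).injective
    apply mul_left_cancel₀ hK2
    apply mul_left_cancel₀ hr0
    linear_combination h - h'
  apply Subtype.ext
  apply sl_ext
  · exact e1
  · rw [a2, b2, e2]
  · exact e2
  · rw [← a1, ← b1, e1]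

/-- The torus as the set of points of a conic. -/
def torusEquiv (n : F) : torus n ≃ {v : F × F // v.1 ^ 2 - n * v.2 ^ 2 = 1} where
  toFun A := ⟨(A.1 0 0, A.1 1 0), by
    have hd := sl_det A.1
    obtain ⟨a1, a2⟩ := A.2
    rw [← a1, a2] at hd
    linear_combination hd⟩
  invFun v := ⟨⟨!![v.1.1, n * v.1.2; v.1.2, v.1.1], by
    rw [Matrix.det_fin_two_of]; linear_combination v.2⟩, rfl, rfl⟩
  left_inv := by
    rintro ⟨A, a1, a2⟩
    apply Subtype.ext
    apply sl_ext
    · rfl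
    · exact a2.symm
    · rfl
    · exact a1
  right_inv := by
    rintro ⟨⟨x, y⟩, h⟩
    rfl

lemma card_torus_one [Fintype F] (h2 : (2 : F) ≠ 0) :
    Nat.card (torus (1 : F)) = Fintype.card F - 1 := by
  classical
  rw [Nat.card_congr (torusEquiv 1)]
  rw [← Fintype.card_units, ← Nat.card_eq_fintype_card]
  apply Nat.card_congr
  refine ⟨fun v => ⟨v.1.1 + v.1.2, v.1.1 - v.1.2, ?_, ?_⟩,
    fun u => ⟨((u + (u⁻¹ : Fˣ)) / 2, (u - (u⁻¹ : Fˣ)) / 2), ?_⟩, ?_, ?_⟩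
  · linear_combination v.2
  · linear_combination v.2
  · have hu : (u : F) * (u⁻¹ : Fˣ) = 1 := u.mul_inv
    simp only
    field_simp
    linear_combination 4 * hu
  · rintro ⟨⟨x, y⟩, h⟩
    apply Subtype.ext
    simp only [Units.inv_mk, Prod.mk.injEq]
    constructor <;> field_simp <;> ring
  · intro u
    apply Units.ext
    simp only
    field_simp
    ring

lemma card_torus_nonsquare [Fintype F] (hF : ringChar F ≠ 2) (h2 : (2 : F) ≠ 0) {n : F}
    (hn : ¬ IsSquare n) : Nat.card (torus n) = Fintype.card F + 1 := by
  classical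
  have hn0 : n ≠ 0 := by rintro rfl; exact hn (IsSquare.zero)
  have key : ∀ m : F, m ≠ 0 → (Nat.card (torus m) : ℤ) =
      ∑ x : F, (quadraticChar F (m⁻¹ * (x ^ 2 - 1)) + 1) := by
    intro m hm
    rw [Nat.card_congr (torusEquiv m)]
    have e : {v : F × F // v.1 ^ 2 - m * v.2 ^ 2 = 1} ≃
        (Σ x : F, {y : F // y ^ 2 = m⁻¹ * (x ^ 2 - 1)}) := by
      refine ⟨fun v => ⟨v.1.1, v.1.2, ?_⟩, fun s => ⟨(s.1, s.2.1), ?_⟩, ?_, ?_⟩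
      · have := v.2
        field_simp
        linear_combination -this
      · have := s.2.2
        simp only
        rw [this]; field_simp; ring
      · intro v; rfl
      · intro s; rfl
    rw [Nat.card_congr e, Nat.card_eq_fintype_card, Fintype.card_sigma, Nat.cast_sum]
    apply Finset.sum_congr rfl
    intro x _
    rw [← quadraticChar_card_sqrts hF]
    congr 1
    rw [Set.toFinset_card]
    rfl
  have h1 := key 1 one_ne_zero
  have hN := key n hn0
  have hchi : quadraticChar F n⁻¹ = -1 := by
    rw [quadraticChar_neg_one_iff_not_isSquare]
    intro h
    apply hn
    rw [← inv_inv n]; exact h.inv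
  have hsum : (Nat.card (torus n) : ℤ) + Nat.card (torus (1 : F)) = 2 * Fintype.card F := by
    rw [h1, hN, ← Finset.sum_add_distrib]
    have : ∀ x ∈ (Finset.univ : Finset F), (quadraticChar F (n⁻¹ * (x ^ 2 - 1)) + 1) +
        (quadraticChar F ((1 : F)⁻¹ * (x ^ 2 - 1)) + 1) = 2 := by
      intro x _
      rw [map_mul, hchi, inv_one, one_mul]; ring
    rw [Finset.sum_congr rfl this]
    simp [mul_comm]
  rw [card_torus_one h2] at hsum
  have : 0 < Fintype.card F := Fintype.card_pos
  omega

lemma exists_conic [Fintype F] (hq : Fintype.card F % 2 = 1) {n : F} (hn : n ≠ 0) :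
    ∃ u v : F, n * v ^ 2 - u ^ 2 = 1 := by
  classical
  obtain ⟨v, u, h⟩ := FiniteField.exists_root_sum_quadratic
    (f := Polynomial.C n * Polynomial.X ^ 2 + Polynomial.C 0 * Polynomial.X + Polynomial.C 0)
    (g := Polynomial.C (-1) * Polynomial.X ^ 2 + Polynomial.C 0 * Polynomial.X + Polynomial.C (-1))
    (Polynomial.degree_quadratic hn) (Polynomial.degree_quadratic (neg_ne_zero.2 one_ne_zero)) hq
  simp only [Polynomial.eval_add, Polynomial.eval_mul, Polynomial.eval_C, Polynomial.eval_pow,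
    Polynomial.eval_X] at h
  exact ⟨u, v, by linear_combination h⟩

lemma torus_inverter [Fintype F] (hq : Fintype.card F % 2 = 1) {n : F} (hn : n ≠ 0) :
    ∃ w : SpecialLinearGroup (Fin 2) F, w ^ 2 = -1 ∧ ∀ t ∈ torus n, w * t * w⁻¹ = t⁻¹ := by
  obtain ⟨u, v, h⟩ := exists_conic hq hn
  obtain ⟨w, w00, w01, w10, w11⟩ := sl_exists u (-(n * v)) v (-u) (by linear_combination h)
  refine ⟨w, ?_, ?_⟩
  · rw [pow_two]
    apply sl_ext <;> simp only [sl_mul, sl_neg, sl_one00, sl_one01, sl_one10, sl_one11,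
      w00, w01, w10, w11]
    · linear_combination (-1 : F) * h
    · ring
    · ring
    · linear_combination (-1 : F) * h
  · rintro t ⟨t1, t2⟩
    rw [mul_inv_eq_iff_eq_mul]
    apply sl_ext <;> simp only [sl_mul, sl_inv00, sl_inv01, sl_inv10, sl_inv11, t1, t2,
      w00, w01, w10, w11] <;> ring

lemma card_SL2 [Fintype F] : Nat.card (SpecialLinearGroup (Fin 2) F) =
    Fintype.card F * ((Fintype.card F - 1) * (Fintype.card F + 1)) := by
  classical
  have hGL := Matrix.card_GL_field (𝔽 := F) 2
  have hq : 1 < Fintype.card F := Fintype.one_lt_card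
  have hker : Nat.card (SpecialLinearGroup (Fin 2) F) * Nat.card Fˣ = Nat.card (GL (Fin 2) F) := by
    have hs : Function.Surjective (GeneralLinearGroup.det : GL (Fin 2) F →* Fˣ) := by
      intro u
      refine ⟨GeneralLinearGroup.mkOfDetNeZero !![(u : F), 0; 0, 1] (by simp), ?_⟩
      apply Units.ext
      simp [GeneralLinearGroup.mkOfDetNeZero]
    have h1 := Subgroup.card_mul_index (GeneralLinearGroup.det : GL (Fin 2) F →* Fˣ).ker
    rw [Subgroup.index_ker, MonoidHom.range_eq_top.2 hs, Subgroup.card_top] at h1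
    rw [← h1]
    congr 1
    apply Nat.card_congr
    refine ⟨fun A => ⟨A.toGL, ?_⟩, fun B => ⟨B.1.1, ?_⟩, ?_, ?_⟩
    · rw [MonoidHom.mem_ker]
      apply Units.ext
      exact A.2
    · have := B.2
      rw [MonoidHom.mem_ker] at this
      exact congrArg Units.val this
    · intro A; rfl
    · intro B; apply Subtype.ext; apply Units.ext; rfl
  rw [hGL, Nat.card_eq_fintype_card (α := Fˣ), Fintype.card_units] at hker
  simp only [Fin.prod_univ_two] at hker
  generalize Fintype.card F = q at *
  obtain ⟨r, rfl⟩ : ∃ r, q = r + 1 := ⟨q - 1, by omega⟩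
  simp only [Fin.val_zero, Fin.val_one, pow_zero, pow_one, Nat.add_sub_cancel] at hker ⊢
  have e1 : (r + 1) ^ 2 - 1 = r * (r + 1 + 1) := by
    rw [show (r + 1) ^ 2 = r * (r + 1 + 1) + 1 by ring]; rfl
  have e2 : (r + 1) ^ 2 - (r + 1) = (r + 1) * r := by
    rw [show (r + 1) ^ 2 = (r + 1) * r + (r + 1) by ring, Nat.add_sub_cancel]
  rw [e1, e2] at hker
  have hr : 0 < r := by omega
  apply Nat.eq_of_mul_eq_mul_right hr
  rw [hker]; ring

end Tori


section PiArith

lemma pi_part (π : Set ℕ) (N : ℕ) (hN : N ≠ 0) : ∃ c c', N = c * c' ∧ IsPiNumber π c ∧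
    ∀ p ∈ π, p.Prime → ¬ p ∣ c' := by
  induction N using induction_on_primes with
  | zero => exact absurd rfl hN
  | one =>
    refine ⟨1, 1, rfl, ?_, ?_⟩
    · intro p hp h; exact absurd (Nat.dvd_one.1 h) hp.ne_one
    · intro p _ hp h; exact absurd (Nat.dvd_one.1 h) hp.ne_one
  | prime_mul r N hr ih =>
    obtain ⟨c, c', h, h1, h2⟩ := ih (by rintro rfl; simp at hN)
    by_cases hrp : r ∈ π
    · refine ⟨r * c, c', by rw [h, mul_assoc], ?_, h2⟩
      intro p hp hd
      rcases (Nat.Prime.dvd_mul hp).1 hd with h | h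
      · rw [(Nat.prime_dvd_prime_iff_eq hp hr).1 h]; exact hrp
      · exact h1 p hp h
    · refine ⟨c, r * c', by rw [h]; ring, h1, ?_⟩
      intro p hpp hp hd
      rcases (Nat.Prime.dvd_mul hp).1 hd with h | h
      · rw [(Nat.prime_dvd_prime_iff_eq hp hr).1 h] at hpp; exact hrp hpp
      · exact h2 p hpp hp h

lemma pi_coprime {π : Set ℕ} {c d : ℕ} (hc : IsPiNumber π c) (hd : ∀ p ∈ π, p.Prime → ¬ p ∣ d) :
    Nat.Coprime c d := by
  by_contra h
  obtain ⟨p, hp, h1, h2⟩ := Nat.Prime.not_coprime_iff_dvd.1 h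
  exact hd p (hc p hp h1) hp h2

lemma pi_mul {π : Set ℕ} {c d : ℕ} (hc : IsPiNumber π c) (hd : IsPiNumber π d) :
    IsPiNumber π (c * d) := by
  intro p hp h
  rcases (Nat.Prime.dvd_mul hp).1 h with h | h
  · exact hc p hp h
  · exact hd p hp h

lemma pi_free_mul {π : Set ℕ} {c d : ℕ} (hc : ∀ p ∈ π, p.Prime → ¬ p ∣ c)
    (hd : ∀ p ∈ π, p.Prime → ¬ p ∣ d) : ∀ p ∈ π, p.Prime → ¬ p ∣ c * d := by
  intro p hpp hp h
  rcases (Nat.Prime.dvd_mul hp).1 h with h | h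
  · exact hc p hpp hp h
  · exact hd p hpp hp h

lemma pi_unique {π : Set ℕ} {c d c' d' : ℕ} (h : c * c' = d * d') (hc : IsPiNumber π c)
    (hd : IsPiNumber π d) (hc' : ∀ p ∈ π, p.Prime → ¬ p ∣ c')
    (hd' : ∀ p ∈ π, p.Prime → ¬ p ∣ d') : c = d := by
  apply Nat.dvd_antisymm
  · exact (pi_coprime hc hd').dvd_of_dvd_mul_right (h ▸ Dvd.intro _ rfl)
  · exact (pi_coprime hd hc').dvd_of_dvd_mul_right (h ▸ Dvd.intro _ rfl)

lemma mem_conjSub {G : Type*} [Group G] {g x : G} {K : Subgroup G} :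
    x ∈ conjSub g K ↔ g⁻¹ * x * g ∈ K := by
  constructor
  · rintro ⟨y, hy, rfl⟩
    have : g⁻¹ * (g * y * g⁻¹) * g = y := by group
    change g⁻¹ * (g * y * g⁻¹) * g ∈ K
    rw [this]; exact hy
  · intro h
    refine ⟨_, h, ?_⟩
    change g * (g⁻¹ * x * g) * g⁻¹ = x
    group

lemma conj_mem_conjSub {G : Type*} [Group G] {g x : G} {K : Subgroup G} (h : x ∈ K) :
    g * x * g⁻¹ ∈ conjSub g K := ⟨x, h, rfl⟩

lemma card_conjSub {G : Type*} [Group G] (g : G) (K : Subgroup G) :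
    Nat.card (conjSub g K) = Nat.card K :=
  Nat.card_congr (K.equivMapOfInjective _ (MulAut.conj g).injective).symm.toEquiv

end PiArith

section TorusDataSec

open Matrix

variable {F : Type*} [Field F]

/-- A torus `T` of order `N`, a subgroup `A` of order `a`, a subgroup `D` containing `A` with
index two and an element `w` of `D` inverting `T`. -/
structure TorusData (n : F) (N a : ℕ) (T A D : Subgroup (SpecialLinearGroup (Fin 2) F))
    (w : SpecialLinearGroup (Fin 2) F) : Prop where
  comm : ∀ x ∈ T, ∀ y ∈ T, Commute x y
  self : ∀ x ∈ T, x ≠ 1 → x ≠ -1 → ∀ y, Commute x y → y ∈ T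
  disc : ∀ x ∈ T, ∃ s : F, (x 0 0 + x 1 1) ^ 2 - 4 = n * s ^ 2
  cardT : Nat.card T = N
  hAT : A ≤ T
  cardA : Nat.card A = a
  hAD : A ≤ D
  cardD : Nat.card D = 2 * a
  hw : w ∈ D
  inv : ∀ t ∈ T, w * t * w⁻¹ = t⁻¹
  sq : ∀ d ∈ D, d ^ 2 ∈ A

lemma sl_trace_conj' (g x : SpecialLinearGroup (Fin 2) F) :
    (g⁻¹ * x * g) 0 0 + (g⁻¹ * x * g) 1 1 = x 0 0 + x 1 1 := by
  have := sl_trace_conj g⁻¹ x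
  rwa [inv_inv] at this

lemma conj_comm_iff {G : Type*} [Group G] (g x y : G) :
    Commute (g⁻¹ * x * g) (g⁻¹ * y * g) ↔ Commute x y := by
  constructor
  · intro h
    have := h.eq
    have h2 : g⁻¹ * (x * y) * g = g⁻¹ * (y * x) * g := by
      calc g⁻¹ * (x * y) * g = g⁻¹ * x * g * (g⁻¹ * y * g) := by group
        _ = _ := this
        _ = _ := by group
    exact mul_left_cancel (mul_right_cancel h2)
  · intro h
    have h : x * y = y * x := h
    calc g⁻¹ * x * g * (g⁻¹ * y * g) = g⁻¹ * (x * y) * g := by group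
      _ = g⁻¹ * (y * x) * g := by rw [h]
      _ = _ := by group

lemma conj_eq_one' {G : Type*} [Group G] {g x : G} (h : g⁻¹ * x * g = 1) : x = 1 := by
  have : x = g * (g⁻¹ * x * g) * g⁻¹ := by group
  rw [this, h]; group

lemma sl_conj_eq_neg {g x : SpecialLinearGroup (Fin 2) F} (h : g⁻¹ * x * g = -1) : x = -1 := by
  have : x = g * (g⁻¹ * x * g) * g⁻¹ := by group
  rw [this, h, mul_neg, neg_mul, mul_one, mul_inv_cancel]

lemma TorusData.conj {n : F} {N a : ℕ} {T A D : Subgroup (SpecialLinearGroup (Fin 2) F)}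
    {w : SpecialLinearGroup (Fin 2) F} (h : TorusData n N a T A D w)
    (g : SpecialLinearGroup (Fin 2) F) :
    TorusData n N a (conjSub g T) (conjSub g A) (conjSub g D) (g * w * g⁻¹) where
  comm x hx y hy := by
    rw [mem_conjSub] at hx hy
    exact (conj_comm_iff g x y).1 (h.comm _ hx _ hy)
  self x hx h1 h2 y hc := by
    rw [mem_conjSub] at hx ⊢
    exact h.self _ hx (fun e => h1 (conj_eq_one' e)) (fun e => h2 (sl_conj_eq_neg e)) _
      ((conj_comm_iff g x y).2 hc)
  disc x hx := by
    rw [mem_conjSub] at hx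
    have := h.disc _ hx
    rwa [sl_trace_conj'] at this
  cardT := by rw [card_conjSub, h.cardT]
  hAT := Subgroup.map_mono h.hAT
  cardA := by rw [card_conjSub, h.cardA]
  hAD := Subgroup.map_mono h.hAD
  cardD := by rw [card_conjSub, h.cardD]
  hw := conj_mem_conjSub h.hw
  inv t ht := by
    rw [mem_conjSub] at ht
    have := h.inv _ ht
    calc g * w * g⁻¹ * t * (g * w * g⁻¹)⁻¹ = g * (w * (g⁻¹ * t * g) * w⁻¹) * g⁻¹ := by group
      _ = _ := by rw [this]; group
  sq d hd := by
    rw [mem_conjSub] at hd ⊢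
    have := h.sq _ hd
    have e : (g⁻¹ * d * g) ^ 2 = g⁻¹ * d ^ 2 * g := by rw [pow_two, pow_two]; group
    rwa [e] at this

lemma exists_torusData [Fintype F] (hq : Fintype.card F % 2 = 1) (h2 : (2 : F) ≠ 0) {n : F}
    (hn : n ≠ 0) {N a : ℕ} (hN : Nat.card (torus n) = N) (ha : a ∣ N) (ha2 : 2 ∣ a) :
    ∃ T A D w, TorusData n N a T A D w := by
  have := torus_cyclic h2 hn
  obtain ⟨⟨g, hg⟩, hgo⟩ := IsCyclic.exists_ofOrder_eq_natCard (α := torus n)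
  rw [hN, Subgroup.orderOf_mk] at hgo
  have hN0 : N ≠ 0 := by rw [← hN]; exact Nat.card_pos.ne'
  obtain ⟨k, hk⟩ := ha
  have hk0 : k ≠ 0 := by rintro rfl; simp at hk; exact hN0 hk
  have ha0 : a ≠ 0 := by rintro rfl; simp at hk; exact hN0 hk
  let A := Subgroup.zpowers (g ^ k)
  have hAc : Nat.card A = a := by
    rw [Nat.card_zpowers, orderOf_pow_of_dvd hk0 (by rw [hgo, hk]; exact Dvd.intro_left _ rfl),
      hgo, hk, Nat.mul_div_cancel _ (Nat.pos_of_ne_zero hk0)]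
  have hAT : A ≤ torus n := by
    rw [Subgroup.zpowers_le]; exact pow_mem hg k
  have hneg : (-1 : SpecialLinearGroup (Fin 2) F) ∈ A := by
    have : Fact (Nat.Prime 2) := ⟨Nat.prime_two⟩
    obtain ⟨⟨x, hx⟩, hxo⟩ := exists_prime_orderOf_dvd_card' (G := A) 2 (by rw [hAc]; exact ha2)
    rw [Subgroup.orderOf_mk] at hxo
    have hx2 : x ^ 2 = 1 := orderOf_dvd_iff_pow_eq_one.1 (by rw [hxo])
    rcases sl_sq_eq_one h2 (eq_inv_of_mul_eq_one_left (by rw [← pow_two]; exact hx2)) with h | h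
    · rw [h, orderOf_one] at hxo; norm_num at hxo
    · rw [← h]; exact hx
  obtain ⟨w, hw2, hinv⟩ := torus_inverter hq hn
  have hwA : w ∉ A := by
    intro h
    have := hinv w (hAT h)
    rw [mul_inv_cancel_right] at this
    have h1 : w ^ 2 = 1 := by rw [pow_two]; nth_rewrite 2 [this]; exact mul_inv_cancel w
    exact sl_one_ne_neg h2 (h1.symm.trans hw2)
  obtain ⟨D, h1, h3, h4, h5, -⟩ := ext_sub A w 2 Nat.prime_two
    (fun y hy => by rw [hinv y (hAT hy)]; exact inv_mem hy) (by rw [hw2]; exact hneg) hwA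
  refine ⟨torus n, A, D, w, ?_⟩
  exact {
    comm := fun x hx y hy => torus_comm hx hy
    self := fun x hx k1 k2 y hc => torus_self hx k1 k2 hc
    disc := fun x hx => torus_disc hx
    cardT := hN
    hAT := hAT
    cardA := hAc
    hAD := h1
    cardD := by rw [h4, hAc]
    hw := h3
    inv := hinv
    sq := h5 }

end TorusDataSec


section Quaternions

open Matrix

variable {F : Type*} [Field F]

/-- A binary tetrahedral subgroup `L` with generators `i`, `j`, `u`. -/
structure QuatData (s t : F) (i j u : SpecialLinearGroup (Fin 2) F)
    (L : Subgroup (SpecialLinearGroup (Fin 2) F)) : Prop where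
  hst : s ^ 2 + t ^ 2 = -1
  i00 : i 0 0 = 0
  i01 : i 0 1 = -1
  i10 : i 1 0 = 1
  i11 : i 1 1 = 0
  j00 : j 0 0 = s
  j01 : j 0 1 = t
  j10 : j 1 0 = t
  j11 : j 1 1 = -s
  ii : i * i = -1
  jj : j * j = -1
  ji : j * i = -(i * j)
  u3 : u ^ 3 = 1
  ui : u * i = j * u
  uj : u * j = i * j * u
  uk : u * (i * j) = i * u
  iL : i ∈ L
  jL : j ∈ L
  uL : u ∈ L
  card : Nat.card L = 24
  four : ∀ x ∈ L, x ^ 4 = 1 → x = 1 ∨ x = -1 ∨ x = i ∨ x = -i ∨ x = j ∨ x = -j ∨ x = i * j ∨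
    x = -(i * j)

lemma quat_inv {G : Type*} [Group G] [HasDistribNeg G] {i : G} (h : i * i = -1) : i⁻¹ = -i := by
  rw [inv_eq_iff_mul_eq_one, mul_neg, h, neg_neg]

lemma exists_quat_group [Finite F] (h2 : (2 : F) ≠ 0) {i j u : SpecialLinearGroup (Fin 2) F}
    (ii : i * i = -1) (jj : j * j = -1) (ji : j * i = -(i * j)) (u3 : u ^ 3 = 1)
    (ui : u * i = j * u) (uj : u * j = i * j * u) (uk : u * (i * j) = i * u) :
    ∃ L : Subgroup (SpecialLinearGroup (Fin 2) F), i ∈ L ∧ j ∈ L ∧ u ∈ L ∧ Nat.card L = 24 ∧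
      ∀ x ∈ L, x ^ 4 = 1 → x = 1 ∨ x = -1 ∨ x = i ∨ x = -i ∨ x = j ∨ x = -j ∨ x = i * j ∨
        x = -(i * j) := by
  have hne := sl_one_ne_neg h2
  have iinv := quat_inv ii
  have jinv := quat_inv jj
  have i4 : i ^ 4 = 1 := by
    rw [show i ^ 4 = (i * i) * (i * i) by simp only [pow_succ, pow_zero, one_mul, mul_assoc], ii, neg_mul_neg, one_mul]
  have ncomm : j * i ≠ i * j := by
    intro h
    rw [ji] at h
    apply hne
    have h' : (-1) * (i * j) = 1 * (i * j) := by rw [neg_one_mul, one_mul, h]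
    exact (mul_right_cancel h').symm
  have oi : orderOf i = 4 := by
    have : orderOf i = 2 ^ (1 + 1) := by
      apply orderOf_eq_prime_pow
      · rw [pow_one, pow_two, ii]; exact fun h => hne h.symm
      · exact i4
    exact this
  have hzi : ∀ y ∈ Subgroup.zpowers i, y = 1 ∨ y = i ∨ y = -1 ∨ y = -i := by
    intro y hy
    rw [← mem_powers_iff_mem_zpowers, Submonoid.mem_powers_iff] at hy
    obtain ⟨k, rfl⟩ := hy
    rw [← pow_mod_orderOf, oi]
    have hk : k % 4 < 4 := Nat.mod_lt _ (by norm_num)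
    have i3 : i ^ 3 = -i := by
      rw [show i ^ 3 = (i * i) * i by simp only [pow_succ, pow_zero, one_mul, mul_assoc], ii, neg_one_mul]
    generalize k % 4 = m at *
    interval_cases m
    · left; exact pow_zero i
    · right; left; exact pow_one i
    · right; right; left; rw [pow_two]; exact ii
    · right; right; right; exact i3
  have hji : j * i * j⁻¹ = i⁻¹ := by
    rw [ji, jinv, iinv, neg_mul_neg, mul_assoc, jj, mul_neg, mul_one]
  obtain ⟨Q, hQ1, hQj, hQc, -, hQ⟩ := ext_sub (Subgroup.zpowers i) j 2 Nat.prime_two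
    (by
      rintro y ⟨m, rfl⟩
      have : j * i ^ m * j⁻¹ = (j * i * j⁻¹) ^ m := by rw [conj_zpow]
      simp only [this, hji]
      exact zpow_mem (inv_mem (Subgroup.mem_zpowers i)) m)
    (by rw [pow_two, jj, ← ii]; exact mul_mem (Subgroup.mem_zpowers i) (Subgroup.mem_zpowers i))
    (by
      rintro ⟨m, hm⟩
      apply ncomm
      simp only at hm
      rw [← hm]
      exact ((Commute.refl i).zpow_left m).eq)
  have hQi : i ∈ Q := hQ1 (Subgroup.mem_zpowers i)
  have hQn : ∀ x ∈ Q, -x ∈ Q := by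
    intro x hx
    have : -x = i * i * x := by rw [ii, neg_one_mul]
    rw [this]; exact mul_mem (mul_mem hQi hQi) hx
  have hlist : ∀ x ∈ Q, x = 1 ∨ x = -1 ∨ x = i ∨ x = -i ∨ x = j ∨ x = -j ∨ x = i * j ∨
        x = -(i * j) := by
    intro x hx
    obtain ⟨m, hm, y, hy, rfl⟩ := hQ x hx
    interval_cases m
    · rw [pow_zero, mul_one]
      rcases hzi y hy with h | h | h | h <;> simp only [h, true_or, or_true]
    · rw [pow_one]
      rcases hzi y hy with h | h | h | h <;> simp only [h, one_mul, neg_mul, true_or, or_true]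
  have hconj : ∀ y ∈ Q, u * y * u⁻¹ ∈ Q := by
    intro y hy
    have ci : u * i * u⁻¹ = j := by rw [ui, mul_inv_cancel_right]
    have cj : u * j * u⁻¹ = i * j := by rw [uj, mul_inv_cancel_right]
    have ck : u * (i * j) * u⁻¹ = i := by rw [uk, mul_inv_cancel_right]
    rcases hlist y hy with h | h | h | h | h | h | h | h <;> rw [h] <;>
      simp only [mul_neg, neg_mul, mul_one, mul_inv_cancel, ci, cj, ck]
    · exact one_mem _
    · exact hQn _ (one_mem _)
    · exact hQj
    · exact hQn _ hQj
    · exact mul_mem hQi hQj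
    · exact hQn _ (mul_mem hQi hQj)
    · exact hQi
    · exact hQn _ hQi
  have h8 : ∀ y ∈ Q, y ^ 8 = 1 := by
    intro y hy
    have : y ^ Nat.card Q = 1 := by
      have := pow_card_eq_one' (x := (⟨y, hy⟩ : Q))
      exact congrArg Subtype.val this
    rwa [hQc, Nat.card_zpowers, oi] at this
  have huQ : u ∉ Q := by
    intro hu
    have h8 := h8 u hu
    have h9 : u ^ 9 = 1 := by rw [show u ^ 9 = (u ^ 3) ^ 3 by group, u3, one_pow]
    have h1 : u = 1 := by
      rw [pow_succ, h8, one_mul] at h9; exact h9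
    rw [h1, one_mul, mul_one] at ui
    exact ncomm (by rw [ui])
  obtain ⟨L, hL1, hLu, hLc, hL3, -⟩ := ext_sub Q u 3 Nat.prime_three hconj
    (by rw [u3]; exact one_mem _) huQ
  refine ⟨L, hL1 hQi, hL1 hQj, hLu, by rw [hLc, hQc, Nat.card_zpowers, oi], ?_⟩
  intro x hx hx4
  apply hlist
  have := inv_mem (hL3 x hx)
  have e : (x ^ 3)⁻¹ = x := by
    rw [inv_eq_iff_mul_eq_one, ← pow_succ]; exact hx4
  rwa [e] at this

lemma exists_quat [Fintype F] (hq : Fintype.card F % 2 = 1) (h2 : (2 : F) ≠ 0) :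
    ∃ s t i j u L, QuatData (F := F) s t i j u L := by
  obtain ⟨s, t, h⟩ := exists_conic hq (n := (-1 : F)) (neg_ne_zero.2 one_ne_zero)
  have hst : s ^ 2 + t ^ 2 = -1 := by linear_combination -h
  obtain ⟨c, hc⟩ : ∃ c : F, 2 * c = 1 := ⟨2⁻¹, mul_inv_cancel₀ h2⟩
  obtain ⟨i, i00, i01, i10, i11⟩ := sl_exists (0 : F) (-1) 1 0 (by ring)
  obtain ⟨j, j00, j01, j10, j11⟩ := sl_exists s t t (-s) (by linear_combination -hst)
  obtain ⟨u, u00, u01, u10, u11⟩ := sl_exists (c * (-1 - s + t)) (c * (1 - t - s))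
    (c * (-1 - t - s)) (c * (-1 + s - t)) (by
      linear_combination (-2 * c ^ 2) * hst + (2 * c + 1) * hc)
  have ii : i * i = -1 := by
    apply sl_ext <;> simp only [sl_mul, sl_neg, sl_one00, sl_one01, sl_one10, sl_one11,
      i00, i01, i10, i11] <;> ring
  have jj : j * j = -1 := by
    apply sl_ext <;> simp only [sl_mul, sl_neg, sl_one00, sl_one01, sl_one10, sl_one11,
      j00, j01, j10, j11] <;> grind
  have ji : j * i = -(i * j) := by
    apply sl_ext <;> simp only [sl_mul, sl_neg, i00, i01, i10, i11, j00, j01, j10, j11] <;> ring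
  have ui : u * i = j * u := by
    apply sl_ext <;> simp only [sl_mul, i00, i01, i10, i11, j00, j01, j10, j11,
      u00, u01, u10, u11] <;> grind
  have uj : u * j = i * j * u := by
    apply sl_ext <;> simp only [sl_mul, i00, i01, i10, i11, j00, j01, j10, j11,
      u00, u01, u10, u11] <;> grind
  have uk : u * (i * j) = i * u := by
    apply sl_ext <;> simp only [sl_mul, i00, i01, i10, i11, j00, j01, j10, j11,
      u00, u01, u10, u11] <;> grind
  have uu : u * u = u⁻¹ := by
    apply sl_ext <;> simp only [sl_mul, sl_inv00, sl_inv01, sl_inv10, sl_inv11,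
      u00, u01, u10, u11] <;> grind
  have u3 : u ^ 3 = 1 := by
    rw [pow_succ, pow_two, uu, inv_mul_cancel]
  obtain ⟨L, iL, jL, uL, hc, h4⟩ := exists_quat_group h2 ii jj ji u3 ui uj uk
  exact ⟨s, t, i, j, u, L, ⟨hst, i00, i01, i10, i11, j00, j01, j10, j11, ii, jj, ji, u3, ui, uj,
    uk, iL, jL, uL, hc, h4⟩⟩

lemma QuatData.not_comm (h2 : (2 : F) ≠ 0) {s t : F} {i j u : SpecialLinearGroup (Fin 2) F}
    {L : Subgroup (SpecialLinearGroup (Fin 2) F)} (h : QuatData s t i j u L) : ¬ Commute i j := by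
  intro hc
  have e : -(i * j) = i * j := h.ji.symm.trans hc.symm.eq
  apply sl_one_ne_neg h2
  have h' : (-1) * (i * j) = 1 * (i * j) := by rw [neg_one_mul, one_mul, e]
  exact (mul_right_cancel h').symm

lemma QuatData.i_eq {s t : F} {i j u : SpecialLinearGroup (Fin 2) F}
    {L : Subgroup (SpecialLinearGroup (Fin 2) F)} (h : QuatData s t i j u L) :
    i = u * (j * u⁻¹ * j⁻¹) := by
  have : u * (j * u⁻¹ * j⁻¹) = (u * j) * u⁻¹ * j⁻¹ := by group
  rw [this, h.uj]; group

lemma QuatData.j_eq {s t : F} {i j u : SpecialLinearGroup (Fin 2) F}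
    {L : Subgroup (SpecialLinearGroup (Fin 2) F)} (h : QuatData s t i j u L) :
    j = u * (i * j * u⁻¹ * (i * j)⁻¹) := by
  have : u * (i * j * u⁻¹ * (i * j)⁻¹) = (u * (i * j)) * u⁻¹ * (i * j)⁻¹ := by group
  rw [this, h.uk]
  have : i * u * u⁻¹ * (i * j)⁻¹ = i * j⁻¹ * i⁻¹ := by group
  rw [this, quat_inv h.ii, quat_inv h.jj, mul_neg, mul_neg, neg_mul, neg_neg]
  have e : i * j = -(j * i) := by rw [h.ji, neg_neg]
  rw [e, neg_mul, mul_assoc, h.ii, mul_neg, mul_one, neg_neg]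

lemma cube_conj {G : Type*} [Group G] {u : G} (h : u ^ 3 = 1) (g : G) : (g * u⁻¹ * g⁻¹) ^ 3 = 1 := by
  rw [conj_pow, inv_pow, h]; group

lemma QuatData.conj_i {s t : F} {i j u : SpecialLinearGroup (Fin 2) F}
    {L : Subgroup (SpecialLinearGroup (Fin 2) F)} (h : QuatData s t i j u L)
    {x : SpecialLinearGroup (Fin 2) F} (hx : x ∈ L) (hx4 : x ^ 4 = 1) (h1 : x ≠ 1) (h2 : x ≠ -1) :
    ∃ c ∈ L, x * c = c * i := by
  rcases h.four x hx hx4 with e | e | e | e | e | e | e | e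
  · exact absurd e h1
  · exact absurd e h2
  · exact ⟨1, one_mem _, by rw [e, mul_one, one_mul]⟩
  · exact ⟨j, h.jL, by rw [e, h.ji, neg_mul]⟩
  · exact ⟨u, h.uL, by rw [e, h.ui]⟩
  · refine ⟨u * j, mul_mem h.uL h.jL, ?_⟩
    rw [e, mul_assoc u, h.ji, neg_mul, mul_neg, ← mul_assoc, ← mul_assoc, ← h.ui]
  · refine ⟨u * u, mul_mem h.uL h.uL, ?_⟩
    rw [e, mul_assoc u u, h.ui, ← mul_assoc, ← mul_assoc, ← h.uj]
  · refine ⟨u * u * j, mul_mem (mul_mem h.uL h.uL) h.jL, ?_⟩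
    rw [e, mul_assoc (u * u), h.ji, neg_mul, mul_neg]
    congr 1
    rw [← mul_assoc (u * u) i j, mul_assoc u u i, h.ui, ← mul_assoc u j u, h.uj]
    simp only [mul_assoc]

/-- A matrix normalizing the quaternion group has square determinant if `2` is a square. -/
lemma QuatData.det_square (h2 : (2 : F) ≠ 0) (h2s : IsSquare (2 : F)) {s t : F}
    {i j u : SpecialLinearGroup (Fin 2) F}
    {L : Subgroup (SpecialLinearGroup (Fin 2) F)} (h : QuatData s t i j u L)
    (M : Matrix (Fin 2) (Fin 2) F) (hM : M.det ≠ 0) {y : SpecialLinearGroup (Fin 2) F} (hy : y ∈ L)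
    (hy4 : y ^ 4 = 1) (ei : M * i.1 = i.1 * M) (ej : M * j.1 = y.1 * M) : IsSquare M.det := by
  have mm : ∀ (A B : Matrix (Fin 2) (Fin 2) F) (k l : Fin 2),
      (A * B) k l = A k 0 * B 0 l + A k 1 * B 1 l := by
    intro A B k l
    rw [Matrix.mul_apply, Fin.sum_univ_two]
  have fi : ∀ k l, (M * i.1) k l = (i.1 * M) k l := by intro k l; rw [ei]
  have fj : ∀ k l, (M * j.1) k l = (y.1 * M) k l := by intro k l; rw [ej]
  simp only [mm] at fi fj
  have hst := h.hst
  have i00 : i.1 0 0 = 0 := h.i00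
  have i01 : i.1 0 1 = -1 := h.i01
  have i10 : i.1 1 0 = 1 := h.i10
  have i11 : i.1 1 1 = 0 := h.i11
  have j00 : j.1 0 0 = s := h.j00
  have j01 : j.1 0 1 = t := h.j01
  have j10 : j.1 1 0 = t := h.j10
  have j11 : j.1 1 1 = -s := h.j11
  have k00 : (i * j).1 0 0 = -t := by rw [sl_mul, h.i00, h.i01, h.j00, h.j10]; ring
  have k01 : (i * j).1 0 1 = s := by rw [sl_mul, h.i00, h.i01, h.j01, h.j11]; ring
  have k10 : (i * j).1 1 0 = s := by rw [sl_mul, h.i10, h.i11, h.j00, h.j10]; ring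
  have k11 : (i * j).1 1 1 = t := by rw [sl_mul, h.i10, h.i11, h.j01, h.j11]; ring
  have f00 := fi 0 0
  have f01 := fi 0 1
  rw [i00, i01, i10] at f00
  rw [i00, i01, i11] at f01
  have m01 : M 0 1 = - M 1 0 := by linear_combination f00
  have m11 : M 1 1 = M 0 0 := by linear_combination f01
  have ng : ∀ (A : SpecialLinearGroup (Fin 2) F) k l, (-A).1 k l = - A.1 k l := sl_neg
  rw [Matrix.det_fin_two, m01, m11] at hM ⊢
  have g00 := fj 0 0
  have g01 := fj 0 1
  have g10 := fj 1 0
  have g11 := fj 1 1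
  rw [j00, j10, m01] at g00
  rw [j01, j11, m01, m11] at g01
  rw [j00, j10, m11] at g10
  rw [j01, j11, m01, m11] at g11
  obtain ⟨d, hd⟩ := h2s
  generalize M 0 0 = a at *
  generalize M 1 0 = r at *
  have o00 : (1 : SpecialLinearGroup (Fin 2) F).1 0 0 = 1 := rfl
  have o01 : (1 : SpecialLinearGroup (Fin 2) F).1 0 1 = 0 := rfl
  have o10 : (1 : SpecialLinearGroup (Fin 2) F).1 1 0 = 0 := rfl
  have o11 : (1 : SpecialLinearGroup (Fin 2) F).1 1 1 = 1 := rfl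
  rcases h.four y hy hy4 with e | e | e | e | e | e | e | e <;> rw [e] at g00 g01 g10 g11
  · rw [o00, o01] at g00 g01
    rw [o10, o11] at g10 g11
    exfalso; apply hM; grind
  · rw [ng, ng, o00, o01] at g00 g01
    rw [ng, ng, o10, o11] at g10 g11
    exfalso; apply hM; grind
  · rw [i00, i01] at g00 g01
    rw [i10, i11] at g10 g11
    exfalso; apply hM; grind
  · rw [ng, ng, i00, i01] at g00 g01
    rw [ng, ng, i10, i11] at g10 g11
    exfalso; apply hM; grind
  · rw [j00, j01] at g00 g01
    have hr : r = 0 := by grind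
    exact ⟨a, by rw [hr]; ring⟩
  · rw [ng, ng, j00, j01] at g00 g01
    have ha : a = 0 := by grind
    exact ⟨r, by rw [ha]; ring⟩
  · rw [k00, k01] at g00 g01
    have ha : a = r := by grind
    exact ⟨d * a, by rw [← ha]; linear_combination a ^ 2 * hd⟩
  · rw [ng, ng, k00, k01] at g00 g01
    have ha : a = -r := by grind
    exact ⟨d * a, by rw [show r = -a by rw [ha, neg_neg]]; linear_combination a ^ 2 * hd⟩

lemma QuatData.det_square' (h2 : (2 : F) ≠ 0) (h2s : IsSquare (2 : F)) {s t : F}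
    {i j u : SpecialLinearGroup (Fin 2) F}
    {L : Subgroup (SpecialLinearGroup (Fin 2) F)} (h : QuatData s t i j u L)
    (M : Matrix (Fin 2) (Fin 2) F) (hM : M.det ≠ 0) {x y : SpecialLinearGroup (Fin 2) F}
    (hx : x ∈ L) (hx4 : x ^ 4 = 1) (h1 : x ≠ 1) (h1' : x ≠ -1) (hy : y ∈ L)
    (hy4 : y ^ 4 = 1) (ei : M * i.1 = x.1 * M) (ej : M * j.1 = y.1 * M) : IsSquare M.det := by
  obtain ⟨c, hc, hxc⟩ := h.conj_i hx hx4 h1 h1'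
  have hdet : (c⁻¹.1 * M).det = M.det := by
    rw [Matrix.det_mul, c⁻¹.2, one_mul]
  rw [← hdet] at hM ⊢
  have e1 : c⁻¹ * x = i * c⁻¹ := by
    rw [inv_mul_eq_iff_eq_mul, ← mul_assoc, ← hxc, mul_inv_cancel_right]
  have e2 : c⁻¹ * y = (c⁻¹ * y * c) * c⁻¹ := by group
  apply h.det_square h2 h2s _ hM (y := c⁻¹ * y * c) (mul_mem (mul_mem (inv_mem hc) hy) hc)
  · have := conj_pow (i := 4) (a := c⁻¹) (b := y)
    rw [inv_inv] at this
    rw [this, hy4]; group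
  · have e1' : c⁻¹.1 * x.1 = i.1 * c⁻¹.1 := congrArg Subtype.val e1
    rw [Matrix.mul_assoc, ei, ← Matrix.mul_assoc, e1', Matrix.mul_assoc]
  · have e2' : c⁻¹.1 * y.1 = (c⁻¹ * y * c).1 * c⁻¹.1 := congrArg Subtype.val e2
    rw [Matrix.mul_assoc, ej, ← Matrix.mul_assoc, e2', Matrix.mul_assoc]

/-- Conjugation by `diag(n, 1)`. -/
def diagConj (n : F) (hn : n ≠ 0) : SpecialLinearGroup (Fin 2) F →* SpecialLinearGroup (Fin 2) F :=
  MonoidHom.mk' (fun A => ⟨!![A 0 0, n * A 0 1; n⁻¹ * A 1 0, A 1 1], by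
    rw [Matrix.det_fin_two_of]; refine Eq.trans ?_ (sl_det A); field_simp⟩) (by
    intro A B
    apply sl_ext
    · refine Eq.trans ?_ (sl_mul _ _ _ _).symm
      change (A * B) 0 0 = A 0 0 * B 0 0 + n * A 0 1 * (n⁻¹ * B 1 0)
      rw [sl_mul]; field_simp
    · refine Eq.trans ?_ (sl_mul _ _ _ _).symm
      change n * (A * B) 0 1 = A 0 0 * (n * B 0 1) + n * A 0 1 * B 1 1
      rw [sl_mul]; ring
    · refine Eq.trans ?_ (sl_mul _ _ _ _).symm
      change n⁻¹ * (A * B) 1 0 = n⁻¹ * A 1 0 * B 0 0 + A 1 1 * (n⁻¹ * B 1 0)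
      rw [sl_mul]; ring
    · refine Eq.trans ?_ (sl_mul _ _ _ _).symm
      change (A * B) 1 1 = n⁻¹ * A 1 0 * (n * B 0 1) + A 1 1 * B 1 1
      rw [sl_mul]; field_simp)

lemma diagConj_spec (n : F) (hn : n ≠ 0) (A : SpecialLinearGroup (Fin 2) F) :
    !![n, 0; 0, 1] * A.1 = (diagConj n hn A).1 * !![n, 0; 0, 1] := by
  have e : (diagConj n hn A).1 = !![A.1 0 0, n * A.1 0 1; n⁻¹ * A.1 1 0, A.1 1 1] := rfl
  rw [e]
  ext k l
  fin_cases k <;> fin_cases l <;> simp [Matrix.mul_apply, Fin.sum_univ_two] <;> field_simp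

lemma diagConj_inj (n : F) (hn : n ≠ 0) : Function.Injective (diagConj n hn) := by
  intro A B h
  have e : ∀ k l, (diagConj n hn A) k l = (diagConj n hn B) k l := by intro k l; rw [h]
  apply sl_ext
  · exact e 0 0
  · exact mul_left_cancel₀ hn (e 0 1)
  · exact mul_left_cancel₀ (inv_ne_zero hn) (e 1 0)
  · exact e 1 1

end Quaternions


section Assembly

open Matrix

variable {F : Type*} [Field F]

lemma no_tetra_in_dihedral [Fintype F] (h2 : (2 : F) ≠ 0) {n : F} {N b : ℕ}
    {T A D H : Subgroup (SpecialLinearGroup (Fin 2) F)} {w : SpecialLinearGroup (Fin 2) F}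
    (hT : TorusData n N b T A D w) (hDH : D ≤ H) (hc : Nat.card H ≤ 2 * Nat.card D)
    {s t : F} {i j u : SpecialLinearGroup (Fin 2) F}
    {L : Subgroup (SpecialLinearGroup (Fin 2) F)} (h : QuatData s t i j u L)
    {g : SpecialLinearGroup (Fin 2) F} (hg : conjSub g L ≤ H) : False := by
  have key : ∀ y ∈ L, y ^ 3 = 1 → y ∈ conjSub g⁻¹ A := by
    intro y hy hy3
    rw [mem_conjSub, inv_inv]
    have h3 : (g * y * g⁻¹) ^ 3 = 1 := by rw [conj_pow, hy3]; group
    have hD := cube_mem_of_card hDH hc (hg (conj_mem_conjSub hy)) h3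
    have hA := pow_mem (hT.sq _ hD) 2
    have e : ((g * y * g⁻¹) ^ 2) ^ 2 = g * y * g⁻¹ := by
      rw [← pow_mul, show 2 * 2 = 3 + 1 from rfl, pow_succ, h3, one_mul]
    rwa [e] at hA
  have hu := key u h.uL h.u3
  have hi : i ∈ conjSub g⁻¹ A := by
    rw [h.i_eq]
    exact mul_mem hu (key _ (mul_mem (mul_mem h.jL (inv_mem h.uL)) (inv_mem h.jL))
      (cube_conj h.u3 j))
  have hj : j ∈ conjSub g⁻¹ A := by
    rw [h.j_eq]
    have hk := mul_mem h.iL h.jL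
    exact mul_mem hu (key _ (mul_mem (mul_mem hk (inv_mem h.uL)) (inv_mem hk))
      (cube_conj h.u3 (i * j)))
  have hT' := hT.conj g⁻¹
  exact h.not_comm h2 (hT'.comm i (hT'.hAT hi) j (hT'.hAT hj))

lemma no_two_tetra [Fintype F] (h2 : (2 : F) ≠ 0) (h2s : IsSquare (2 : F)) {n : F} (hn : n ≠ 0)
    (hns : ¬ IsSquare n) {H : Subgroup (SpecialLinearGroup (Fin 2) F)} (hc : Nat.card H ≤ 48)
    {s t : F} {i j u : SpecialLinearGroup (Fin 2) F}
    {L : Subgroup (SpecialLinearGroup (Fin 2) F)} (h : QuatData s t i j u L)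
    {g1 g2 : SpecialLinearGroup (Fin 2) F} (hg1 : conjSub g1 L ≤ H)
    (hg2 : conjSub g2 (L.map (diagConj n hn)) ≤ H) : False := by
  let g := g1⁻¹ * g2
  let ψ : SpecialLinearGroup (Fin 2) F →* SpecialLinearGroup (Fin 2) F :=
    (MulAut.conj g).toMonoidHom.comp (diagConj n hn)
  have hψ : ∀ y, ψ y = g * diagConj n hn y * g⁻¹ := fun y => rfl
  have hinj : Function.Injective ψ :=
    (MulAut.conj g).injective.comp (diagConj_inj n hn)
  have hc' : Nat.card H ≤ 2 * Nat.card (conjSub g1 L) := by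
    rw [card_conjSub, h.card]; exact hc
  have key : ∀ y ∈ L, y ^ 3 = 1 → ψ y ∈ L := by
    intro y hy hy3
    have hm : g2 * diagConj n hn y * g2⁻¹ ∈ H :=
      hg2 (conj_mem_conjSub (Subgroup.mem_map_of_mem _ hy))
    have h3 : (g2 * diagConj n hn y * g2⁻¹) ^ 3 = 1 := by
      rw [conj_pow, ← map_pow, hy3, map_one]; group
    have := cube_mem_of_card hg1 hc' hm h3
    rw [mem_conjSub] at this
    rw [hψ]
    have e : g * diagConj n hn y * g⁻¹ = g1⁻¹ * (g2 * diagConj n hn y * g2⁻¹) * g1 := by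
      simp only [g]; group
    rwa [e]
  have hu := key u h.uL h.u3
  have hi : ψ i ∈ L := by
    rw [h.i_eq, map_mul]
    exact mul_mem hu (key _ (mul_mem (mul_mem h.jL (inv_mem h.uL)) (inv_mem h.jL))
      (cube_conj h.u3 j))
  have hj : ψ j ∈ L := by
    rw [h.j_eq, map_mul]
    have hk := mul_mem h.iL h.jL
    exact mul_mem hu (key _ (mul_mem (mul_mem hk (inv_mem h.uL)) (inv_mem hk))
      (cube_conj h.u3 (i * j)))
  have four : ∀ y : SpecialLinearGroup (Fin 2) F, y * y = -1 → (ψ y) ^ 4 = 1 := by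
    intro y hy
    have : y ^ 4 = 1 := by
      rw [show y ^ 4 = (y * y) * (y * y) by simp only [pow_succ, pow_zero, one_mul, mul_assoc], hy,
        neg_mul_neg, one_mul]
    rw [← map_pow, this, map_one]
  have hne : ¬ (ψ i * ψ i = 1) := by
    intro e
    rw [← map_mul, h.ii] at e
    have : (-1 : SpecialLinearGroup (Fin 2) F) = 1 := hinj (by rw [e, map_one])
    exact sl_one_ne_neg h2 this.symm
  let M : Matrix (Fin 2) (Fin 2) F := g.1 * !![n, 0; 0, 1]
  have hdet : M.det = n := by
    change (g.1 * !![n, 0; 0, 1]).det = n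
    rw [Matrix.det_mul, g.2, Matrix.det_fin_two_of]; ring
  have comm : ∀ y : SpecialLinearGroup (Fin 2) F, M * y.1 = (ψ y).1 * M := by
    intro y
    have e : ψ y * g = g * diagConj n hn y := by rw [hψ]; group
    have e' : (ψ y).1 * g.1 = g.1 * (diagConj n hn y).1 := congrArg Subtype.val e
    change g.1 * !![n, 0; 0, 1] * y.1 = (ψ y).1 * (g.1 * !![n, 0; 0, 1])
    rw [Matrix.mul_assoc, diagConj_spec n hn, ← Matrix.mul_assoc, ← e', Matrix.mul_assoc]
  apply hns
  rw [← hdet]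
  exact h.det_square' h2 h2s M (by rw [hdet]; exact hn) hi (four i h.ii)
    (fun e => hne (by rw [e, one_mul])) (fun e => hne (by rw [e, neg_mul_neg, one_mul]))
    hj (four j h.jj) (comm i) (comm j)

lemma exists_noncentral {A : Subgroup (SpecialLinearGroup (Fin 2) F)}
    (h : 2 < Nat.card A) : ∃ x ∈ A, x ≠ 1 ∧ x ≠ -1 := by
  by_contra hcon
  push Not at hcon
  have hsub : (A : Set (SpecialLinearGroup (Fin 2) F)) ⊆ {1, -1} := by
    intro x hx
    by_cases h1 : x = 1
    · left; exact h1
    · right; exact hcon x hx h1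
  have h1 := Set.ncard_le_ncard hsub (Set.toFinite _)
  have h3 := Set.ncard_insert_le (1 : SpecialLinearGroup (Fin 2) F) {-1}
  rw [Set.ncard_singleton] at h3
  have h4 : Nat.card A = (A : Set (SpecialLinearGroup (Fin 2) F)).ncard := rfl
  omega

lemma cent_card [Fintype F] {n : F} {N a : ℕ}
    {T A D H : Subgroup (SpecialLinearGroup (Fin 2) F)} [Fintype H]
    {w : SpecialLinearGroup (Fin 2) F}
    (hT : TorusData n N a T A D w) (hDH : D ≤ H)
    (hdiv : ∀ d, d ∣ Nat.card H → d ∣ N → d ∣ a) (x : H) (hx : x.1 ∈ T) (h1 : x.1 ≠ 1)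
    (h2 : x.1 ≠ -1) : (centFin x).card = a := by
  classical
  have hcard : Nat.card (H ⊓ T : Subgroup _) = a := by
    apply Nat.dvd_antisymm
    · apply hdiv
      · exact Subgroup.card_dvd_of_le inf_le_left
      · rw [← hT.cardT]; exact Subgroup.card_dvd_of_le inf_le_right
    · rw [← hT.cardA]
      exact Subgroup.card_dvd_of_le (le_inf (hT.hAD.trans hDH) hT.hAT)
  have hmem : ∀ y : H, y ∈ centFin x ↔ Commute x.1 y.1 := by
    intro y
    simp only [centFin, Finset.mem_filter, Finset.mem_univ, true_and]
    exact ⟨fun h => congrArg Subtype.val h.eq, fun h => Subtype.ext h.eq⟩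
  rw [← hcard, ← Fintype.card_coe, ← Nat.card_eq_fintype_card]
  refine Nat.card_congr ⟨fun y => ⟨y.1.1, y.1.2, hT.self _ hx h1 h2 _ ((hmem _).1 y.2)⟩,
    fun y => ⟨⟨y.1, y.2.1⟩, (hmem _).2 (hT.comm _ hx _ y.2.2)⟩, fun y => rfl, fun y => rfl⟩

/-- The subgroup `{1, -1}` inside `H`. -/
def signSub (H : Subgroup (SpecialLinearGroup (Fin 2) F)) : Subgroup H where
  carrier := {x | x.1 = 1 ∨ x.1 = -1}
  one_mem' := Or.inl rfl
  mul_mem' := by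
    intro a b ha hb
    simp only [Set.mem_setOf_eq, Subgroup.coe_mul] at *
    rcases ha with ha | ha <;> rcases hb with hb | hb <;> rw [ha, hb] <;> simp
  inv_mem' := by
    intro a ha
    simp only [Set.mem_setOf_eq, Subgroup.coe_inv] at *
    rcases ha with ha | ha <;> rw [ha] <;> simp

lemma notMem_signSub {H : Subgroup (SpecialLinearGroup (Fin 2) F)} {x : H} :
    x ∉ signSub H ↔ x.1 ≠ 1 ∧ x.1 ≠ -1 := by
  change ¬ (x.1 = 1 ∨ x.1 = -1) ↔ _
  exact not_or

lemma count_SL [Fintype F] (h2 : (2 : F) ≠ 0) {n : F} (hns : ¬ IsSquare n) {N N' a b : ℕ}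
    {T A D T' A' D' H : Subgroup (SpecialLinearGroup (Fin 2) F)}
    {w w' : SpecialLinearGroup (Fin 2) F}
    (hT : TorusData 1 N a T A D w) (hT' : TorusData n N' b T' A' D' w')
    (hD : D ≤ H) (hD' : D' ≤ H) (hm1 : -1 ∈ H)
    (hdiv : ∀ d, d ∣ Nat.card H → d ∣ N → d ∣ a)
    (hdiv' : ∀ d, d ∣ Nat.card H → d ∣ N' → d ∣ b)
    (hdisc : ∀ x ∈ H, x ≠ 1 → x ≠ -1 → (x 0 0 + x 1 1) ^ 2 - 4 ≠ 0)
    (hc : Nat.card H = a * b) (ha : 2 < a) (hb : 2 < b) : a * b + 8 ≤ 4 * a + 4 * b := by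
  classical
  have : Fintype H := Fintype.ofFinite H
  obtain ⟨x, hxA, hx1, hx2⟩ := exists_noncentral (A := A) (by rw [hT.cardA]; exact ha)
  obtain ⟨y, hyA, hy1, hy2⟩ := exists_noncentral (A := A') (by rw [hT'.cardA]; exact hb)
  have com : ∀ x y : H, Commute x y → Commute x.1 y.1 := fun x y h => congrArg Subtype.val h.eq
  refine count_main (Γ := H) (signSub H) ?_ ?_ ?_ ?_ ?_ (x := ⟨x, hD (hT.hAD hxA)⟩)
    (y := ⟨y, hD' (hT'.hAD hyA)⟩) (v := ⟨w, hD hT.hw⟩) (w := ⟨w', hD' hT'.hw⟩)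
    (notMem_signSub.2 ⟨hx1, hx2⟩) (notMem_signSub.2 ⟨hy1, hy2⟩) ?_ ?_ ?_
    (cent_card hT hD hdiv _ (hT.hAT hxA) hx1 hx2)
    (cent_card hT' hD' hdiv' _ (hT'.hAT hyA) hy1 hy2)
    (by rw [← Nat.card_eq_fintype_card, hc]) ha hb
  · rintro z hz g
    apply Subtype.ext
    rcases hz with hz | hz
    · simp only [Subgroup.coe_mul, Subgroup.coe_inv, hz]; simp
    · simp only [Subgroup.coe_mul, Subgroup.coe_inv, hz]; simp
  · have e : ((signSub H : Subgroup H) : Set H) = {1, ⟨-1, hm1⟩} := by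
      ext z
      change (z.1 = 1 ∨ z.1 = -1) ↔ (z = 1 ∨ z = ⟨-1, hm1⟩)
      rw [Subtype.ext_iff, Subtype.ext_iff]; rfl
    have h4 : Nat.card (signSub H) = (signSub H : Set H).ncard := rfl
    rw [h4, e, Set.ncard_pair]
    intro h
    exact sl_one_ne_neg h2 (congrArg Subtype.val h)
  · intro x y z hy h1 h3
    obtain ⟨e1, e2⟩ := notMem_signSub.1 hy
    exact Subtype.ext (sl_commute_trans e1 e2 (com _ _ h1) (com _ _ h3)).eq
  · intro x g hx h
    obtain ⟨e1, e2⟩ := notMem_signSub.1 hx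
    rcases sl_conj_inv h2 (hdisc _ x.2 e1 e2) (sl_trace_conj g.1 x.1) (com _ _ h) with h | h
    · left; exact Subtype.ext h
    · right; exact Subtype.ext h
  · intro x hx h
    obtain ⟨e1, e2⟩ := notMem_signSub.1 hx
    rcases sl_sq_eq_one h2 (congrArg Subtype.val h) with h | h
    · exact e1 h
    · exact e2 h
  · intro z hz
    exact Subtype.ext (hT.inv _ (hT.self _ (hT.hAT hxA) hx1 hx2 _ (com _ _ hz)))
  · intro z hz
    exact Subtype.ext (hT'.inv _ (hT'.self _ (hT'.hAT hyA) hy1 hy2 _ (com _ _ hz)))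
  · intro h hcom
    have h1 : h.1 * y * h.1⁻¹ ∈ T := hT.self _ (hT.hAT hxA) hx1 hx2 _ (com _ _ hcom)
    obtain ⟨s, hs⟩ := hT.disc _ h1
    obtain ⟨s', hs'⟩ := hT'.disc _ (hT'.hAT hyA)
    rw [sl_trace_conj] at hs
    have h0 := hdisc y (hD' (hT'.hAD hyA)) hy1 hy2
    have hs0 : s' ≠ 0 := by
      rintro rfl
      apply h0
      rw [hs']; ring
    apply hns
    refine ⟨s / s', ?_⟩
    field_simp
    rw [← hs', hs]; ring

end Assembly


section Final

open Matrix

lemma final_core (F : Type*) [Field F] [Fintype F] (hqodd : Odd (Fintype.card F))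
    (π : Set ℕ) (h2 : 2 ∈ π) (h3 : 3 ∈ π) (hp : ringChar F ∉ π)
    (H : Subgroup (SpecialLinearGroup (Fin 2) F)) (hH : IsHallPi π H)
    (hall : ∀ K : Subgroup (SpecialLinearGroup (Fin 2) F), IsPiNumber π (Nat.card K) →
      ∃ g : SpecialLinearGroup (Fin 2) F, conjSub g K ≤ H) : False := by
  classical
  have hq : Fintype.card F % 2 = 1 := Nat.odd_iff.1 hqodd
  have hF2 : ringChar F ≠ 2 := fun h => hp (h ▸ h2)
  have h20 : (2 : F) ≠ 0 := Ring.two_ne_zero hF2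
  obtain ⟨k, hpr, hk⟩ := FiniteField.card F (ringChar F)
  have : Fact (ringChar F).Prime := ⟨hpr⟩
  have hq1 : 1 < Fintype.card F := Fintype.one_lt_card
  obtain ⟨n, hns⟩ := FiniteField.exists_nonsquare hF2
  have hn0 : n ≠ 0 := by rintro rfl; exact hns IsSquare.zero
  have qfree : ∀ p ∈ π, p.Prime → ¬ p ∣ Fintype.card F := by
    intro p hpπ hpp hd
    rw [hk] at hd
    have := (Nat.prime_dvd_prime_iff_eq hpp hpr).1 (hpp.dvd_of_dvd_pow hd)
    exact hp (this ▸ hpπ)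
  obtain ⟨a, a', haa, hap, haf⟩ := pi_part π (Fintype.card F - 1) (by omega)
  obtain ⟨b, b', hbb, hbp, hbf⟩ := pi_part π (Fintype.card F + 1) (by omega)
  have hfree := pi_free_mul qfree (pi_free_mul haf hbf)
  have hab : Nat.card H = a * b := by
    refine pi_unique (c' := H.index) (d' := Fintype.card F * (a' * b')) ?_ hH.1 (pi_mul hap hbp)
      hH.2 hfree
    rw [Subgroup.card_mul_index, card_SL2, haa, hbb]; ring
  have pi2 : IsPiNumber π 2 := by
    intro p hpp hd
    rwa [(Nat.prime_dvd_prime_iff_eq hpp Nat.prime_two).1 hd]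
  have pi3 : IsPiNumber π 3 := by
    intro p hpp hd
    rwa [(Nat.prime_dvd_prime_iff_eq hpp Nat.prime_three).1 hd]
  have pi8 : IsPiNumber π 8 := pi_mul (c := 4) (d := 2) (pi_mul (c := 2) (d := 2) pi2 pi2) pi2
  have pi24 : IsPiNumber π 24 := pi_mul (c := 8) (d := 3) pi8 pi3
  have ha2 : 2 ∣ a := (pi_coprime pi2 haf).dvd_of_dvd_mul_right (by rw [← haa]; omega)
  have hb2 : 2 ∣ b := (pi_coprime pi2 hbf).dvd_of_dvd_mul_right (by rw [← hbb]; omega)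
  have hab8 : 8 ∣ a * b := by
    apply (pi_coprime pi8 (pi_free_mul haf hbf)).dvd_of_dvd_mul_right
    have e : a * b * (a' * b') = (Fintype.card F - 1) * (Fintype.card F + 1) := by
      rw [haa, hbb]; ring
    rw [e]
    obtain ⟨m, hm⟩ : ∃ m, Fintype.card F = 2 * m + 1 := hqodd
    rw [hm]
    have e2 : (2 * m + 1 - 1) * (2 * m + 1 + 1) = 4 * (m * (m + 1)) := by
      rw [Nat.add_sub_cancel]; ring
    rw [e2]
    obtain ⟨c, hc⟩ := (Nat.even_mul_succ_self m).two_dvd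
    exact ⟨c, by rw [hc]; ring⟩
  have ha0 : a ≠ 0 := by rintro rfl; rw [zero_mul] at haa; omega
  have hb0 : b ≠ 0 := by rintro rfl; rw [zero_mul] at hbb; omega
  -- tori
  obtain ⟨T, A, D, w, hT⟩ := exists_torusData hq h20 (one_ne_zero (α := F)) (card_torus_one h20)
    (a := a) (Dvd.intro _ haa.symm) ha2
  obtain ⟨T', A', D', w', hT'⟩ := exists_torusData hq h20 hn0 (card_torus_nonsquare hF2 h20 hns)
    (a := b) (Dvd.intro _ hbb.symm) hb2
  obtain ⟨g, hg⟩ := hall D (by rw [hT.cardD]; exact pi_mul pi2 hap)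
  obtain ⟨g', hg'⟩ := hall D' (by rw [hT'.cardD]; exact pi_mul pi2 hbp)
  have hT := hT.conj g
  have hT' := hT'.conj g'
  obtain ⟨s, t, i, j, u, L, hL⟩ := exists_quat hq h20
  obtain ⟨g1, hg1⟩ := hall L (by rw [hL.card]; exact pi24)
  have hcm : Nat.card (L.map (diagConj n hn0)) = 24 := by
    rw [← hL.card]
    exact (Nat.card_congr (L.equivMapOfInjective _ (diagConj_inj n hn0)).toEquiv).symm
  obtain ⟨g2, hg2⟩ := hall (L.map (diagConj n hn0)) (by rw [hcm]; exact pi24)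
  by_cases ha4 : a ≤ 4
  · refine no_tetra_in_dihedral h20 hT' hg' ?_ hL hg1
    rw [hT'.cardD, hab]; nlinarith
  by_cases hb4 : b ≤ 4
  · refine no_tetra_in_dihedral h20 hT hg ?_ hL hg1
    rw [hT.cardD, hab]; nlinarith
  have hm1 : -1 ∈ H := by
    have : Fact (Nat.Prime 2) := ⟨Nat.prime_two⟩
    obtain ⟨z, hz⟩ := exists_prime_orderOf_dvd_card' (G := H) 2
      (by rw [hab]; exact Dvd.dvd.mul_right ha2 b)
    obtain ⟨e1, e2⟩ := orderOf_eq_prime_iff.1 hz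
    have e3 : z.1 = z.1⁻¹ := by
      have : z.1 ^ 2 = 1 := congrArg Subtype.val e1
      rw [pow_two] at this
      exact eq_inv_of_mul_eq_one_left this
    rcases sl_sq_eq_one h20 e3 with h | h
    · exact absurd (Subtype.ext h) e2
    · rw [← h]; exact z.2
  have hdiv : ∀ c c' N : ℕ, N = c * c' → (∀ p ∈ π, p.Prime → ¬ p ∣ c') →
      ∀ d, d ∣ Nat.card H → d ∣ N → d ∣ c := by
    intro c c' N hN hc' d hd hdN
    have hdp : IsPiNumber π d := fun p hpp hpd => hH.1 p hpp (hpd.trans hd)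
    exact (pi_coprime hdp hc').dvd_of_dvd_mul_right (hN ▸ hdN)
  have hdisc : ∀ x ∈ H, x ≠ 1 → x ≠ -1 → (x 0 0 + x 1 1) ^ 2 - 4 ≠ 0 := by
    intro x hx hx1 hx2
    refine sl_disc_ne_zero (p := ringChar F) h20 hx1 hx2 fun hd => ?_
    exact hp (hH.1 _ hpr (hd.trans (Subgroup.orderOf_dvd_natCard H hx)))
  have hcount := count_SL h20 hns hT hT' hg hg' hm1 (hdiv a a' _ haa haf) (hdiv b b' _ hbb hbf)
    hdisc hab (by omega) (by omega)
  have ha6 : 6 ≤ a := by omega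
  have hb6 : 6 ≤ b := by omega
  have ha8 : a ≤ 8 := by nlinarith
  have hb8 : b ≤ 8 := by nlinarith
  have hcase : (a = 6 ∧ b = 8) ∨ (a = 8 ∧ b = 6) := by
    interval_cases a <;> interval_cases b <;> omega
  have hc48 : Nat.card H ≤ 48 := by
    rw [hab]; rcases hcase with ⟨rfl, rfl⟩ | ⟨rfl, rfl⟩ <;> norm_num
  have h2s : IsSquare (2 : F) := by
    rw [FiniteField.isSquare_two_iff]
    rcases hcase with ⟨rfl, rfl⟩ | ⟨rfl, rfl⟩ <;> omega
  exact no_two_tetra h20 h2s hn0 hns hc48 hL hg1 hg2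

end Final

/-- Let `F` be a finite field of odd order and characteristic `p`, and let `π`
be a set of primes with `2, 3 ∈ π` and `p ∉ π`. If `H` is a `π`-Hall subgroup
of `SL₂(F)`, then there is a `π`-subgroup `K` of `SL₂(F)` no conjugate of
which is contained in `H`; in particular `SL₂(F)` does not satisfy `D_π`. -/
theorem stmt_16 (F : Type*) [Field F] [Fintype F] (hqodd : Odd (Fintype.card F))
    (π : Set ℕ) (h2 : 2 ∈ π) (h3 : 3 ∈ π) (hp : ringChar F ∉ π)
    (H : Subgroup (Matrix.SpecialLinearGroup (Fin 2) F)) (hH : IsHallPi π H) :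
    (∃ K : Subgroup (Matrix.SpecialLinearGroup (Fin 2) F),
      IsPiNumber π (Nat.card K) ∧
      ∀ g : Matrix.SpecialLinearGroup (Fin 2) F, ¬ conjSub g K ≤ H) ∧
    ¬ DPi π (Matrix.SpecialLinearGroup (Fin 2) F) := by
  have key : ∃ K : Subgroup (Matrix.SpecialLinearGroup (Fin 2) F),
      IsPiNumber π (Nat.card K) ∧
      ∀ g : Matrix.SpecialLinearGroup (Fin 2) F, ¬ conjSub g K ≤ H := by
    by_contra hcon
    push Not at hcon
    exact final_core F hqodd π h2 h3 hp H hH hcon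
  refine ⟨key, fun hD => ?_⟩
  obtain ⟨K, hK, hKg⟩ := key
  obtain ⟨H', hH', hKH⟩ := hD.2 K hK
  obtain ⟨g, hg⟩ := hD.1.2 H' H hH' hH
  apply hKg g
  rw [← hg]
  exact Subgroup.map_mono hKH
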